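/- arXiv:1602.00347 — 4 statements merged into one kernel-verified Lean document; each statement's English description precedes it below -/
import Mathlib

section
/- Let G be a finite simple graph with average degree d := 2|E(G)|/|V(G)|, and suppose d ≥ 2e. Then the correspondence chromatic number of G satisfies χ_c(G) ≥ (d/2)/ln(d/2). -/
open Classical Finset Real

/-- A cover `(L, H)` of a graph `G`. Colors form a type `W`; `toFun` sends each color to the
vertex it belongs to, so that the list of `v` is `L v = toFun ⁻¹' {v}` (the lists are then
automatically pairwise disjoint). `graph` is the cover graph `H`. -/
structure Cover {V : Type*} (G : SimpleGraph V) (W : Type*) where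
  toFun : W → V
  graph : SimpleGraph W
  adj_map : ∀ ⦃x y : W⦄, graph.Adj x y → G.Adj (toFun x) (toFun y)
  matching : ∀ ⦃x y y' : W⦄, graph.Adj x y → graph.Adj x y' → toFun y = toFun y' → y = y'

namespace Cover

variable {V W : Type*} {G : SimpleGraph V}

/-- `I` is an `(L,H)`-coloring of `G`: an independent set of `H` meeting every list. -/
def IsColoring (C : Cover G W) (I : Set W) : Prop :=
  (∀ ⦃x⦄, x ∈ I → ∀ ⦃y⦄, y ∈ I → ¬ C.graph.Adj x y) ∧ ∀ v : V, ∃ x ∈ I, C.toFun x = v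

/-- `G` is `(L,H)`-colorable. -/
def Colorable (C : Cover G W) : Prop := ∃ I : Set W, C.IsColoring I

end Cover

/-- `G` is `k`-correspondence-colorable. -/
def CorrColorable {V : Type} [Fintype V] (G : SimpleGraph V) (k : ℕ) : Prop :=
  ∀ (W : Type) [Fintype W] (C : Cover G W),
    (∀ v : V, k ≤ Fintype.card {x : W // C.toFun x = v}) → C.Colorable

/-- The correspondence chromatic number `χ_c(G)`. -/
noncomputable def corrChromaticNumber {V : Type} [Fintype V] (G : SimpleGraph V) : ℕ :=
  sInf {k : ℕ | CorrColorable G k}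

/-- Greedy coloring: lists with at least `|V|` colors always suffice. -/
theorem corrColorable_card {V : Type} [Fintype V] (G : SimpleGraph V) :
    CorrColorable G (Fintype.card V) := by
  intro W _ C hC
  have hne : ∀ v : V, ∃ x, C.toFun x = v := by
    intro v
    have hpos : 0 < Fintype.card {x : W // C.toFun x = v} :=
      (Fintype.card_pos_iff.2 ⟨v⟩).trans_le (hC v)
    obtain ⟨x, hx⟩ := Fintype.card_pos_iff.1 hpos
    exact ⟨x, hx⟩
  have key : ∀ S : Finset V, ∃ c : V → W, (∀ v, C.toFun (c v) = v) ∧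
      ∀ u ∈ S, ∀ v ∈ S, ¬ C.graph.Adj (c u) (c v) := by
    intro S
    induction S using Finset.induction_on with
    | empty =>
      choose c hc using hne
      exact ⟨c, hc, by simp⟩
    | insert v S hv ih =>
      obtain ⟨c, hc, hS⟩ := ih
      obtain ⟨x, hx, hxS⟩ : ∃ x, C.toFun x = v ∧ ∀ u ∈ S, ¬ C.graph.Adj (c u) x := by
        by_contra! hcon
        choose f hfS hf using fun x : {x : W // C.toFun x = v} => hcon x.1 x.2
        have hinj : Function.Injective fun x => (⟨f x, hfS x⟩ : S) := by
          intro x y hxy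
          have hfxy : f x = f y := congrArg Subtype.val hxy
          have hy := hf y
          rw [← hfxy] at hy
          exact Subtype.ext (C.matching (hf x) hy (x.2.trans y.2.symm))
        have h₁ := Fintype.card_le_of_injective _ hinj
        have h₂ := Finset.card_lt_univ_of_notMem hv
        have h₃ := hC v
        rw [Fintype.card_coe] at h₁
        omega
      refine ⟨Function.update c v x, fun w => ?_, fun u hu w hw => ?_⟩
      · by_cases h : w = v
        · subst h; simpa using hx
        · simpa [h] using hc w
      · by_cases h : u = v <;> by_cases h' : w = v
        · subst h; subst h'; simp
        · have hw' : w ∈ S := (Finset.mem_insert.1 hw).resolve_left h'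
          subst h
          simpa [h', C.graph.adj_comm x] using hxS w hw'
        · have hu' : u ∈ S := (Finset.mem_insert.1 hu).resolve_left h
          subst h'
          simpa [h] using hxS u hu'
        · simpa [h, h'] using hS u ((Finset.mem_insert.1 hu).resolve_left h) w
            ((Finset.mem_insert.1 hw).resolve_left h')
  obtain ⟨c, hc, hind⟩ := key Finset.univ
  refine ⟨Set.range c, ?_, fun v => ⟨c v, ⟨v, rfl⟩, hc v⟩⟩
  rintro _ ⟨u, rfl⟩ _ ⟨v, rfl⟩
  exact hind u (Finset.mem_univ u) v (Finset.mem_univ v)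

/-- The cover with list `{v} × A` at each vertex `v`, in which the ends of an edge `e`
conflict when their colors sum to `f e`. -/
def sumCover {V A : Type} [AddCommGroup A] (G : SimpleGraph V) (f : G.edgeSet → A) :
    Cover G (V × A) where
  toFun := Prod.fst
  graph :=
    { Adj := fun x y => ∃ h : G.Adj x.1 y.1, x.2 + y.2 = f ⟨s(x.1, y.1), h⟩
      symm := ⟨by
        rintro x y ⟨h, hxy⟩
        refine ⟨h.symm, ?_⟩
        rw [add_comm, hxy]
        congr 2
        exact Sym2.eq_swap⟩
      loopless := ⟨fun x ⟨h, _⟩ => G.loopless.irrefl _ h⟩ }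
  adj_map := fun _ _ ⟨h, _⟩ => h
  matching := by
    rintro x ⟨v, a⟩ ⟨v', a'⟩ ⟨h, ha⟩ ⟨h', ha'⟩ hv
    dsimp only at hv
    subst hv
    exact Prod.ext rfl (add_left_cancel (ha.trans ha'.symm))

theorem CorrColorable.pos {V : Type} [Fintype V] [Nonempty V] {G : SimpleGraph V} {k : ℕ}
    (h : CorrColorable G k) : 0 < k := by
  rcases Nat.eq_zero_or_pos k with rfl | hk
  · let C : Cover G Empty :=
      { toFun := Empty.elim
        graph := ⊥
        adj_map := fun x => x.elim
        matching := fun x => x.elim }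
    obtain ⟨I, -, hI⟩ := h Empty C fun v => Nat.zero_le _
    obtain ⟨x, -⟩ := hI (Classical.arbitrary V)
    exact x.elim
  · exact hk

/-- Counting covers by sums: each of the `k ^ |V|` choices of colors is independent in only
`(k - 1) ^ |E|` of the `k ^ |E|` covers. -/
theorem CorrColorable.pow_card_edgeSet_le {V : Type} [Fintype V] {G : SimpleGraph V}
    [Fintype G.edgeSet] {k : ℕ} [NeZero k] (h : CorrColorable G k) :
    k ^ Fintype.card G.edgeSet ≤
      k ^ Fintype.card V * (k - 1) ^ Fintype.card G.edgeSet := by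
  let g (σ : V → Fin k) (e : G.edgeSet) : Fin k :=
    Sym2.lift ⟨fun u v => σ u + σ v, fun u v => add_comm _ _⟩ e.1
  have hcov : (Finset.univ : Finset (G.edgeSet → Fin k)) ⊆
      Finset.univ.biUnion fun σ : V → Fin k =>
        Fintype.piFinset fun e => Finset.univ.erase (g σ e) := by
    intro f _
    obtain ⟨I, hI, hV⟩ := h (V × Fin k) (sumCover G f) (by
      intro v
      have hinj : Function.Injective
          fun a : Fin k => (⟨(v, a), rfl⟩ : {x // (sumCover G f).toFun x = v}) := by
        intro a b hab
        exact congrArg (fun x => x.1.2) hab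
      simpa using Fintype.card_le_of_injective _ hinj)
    choose c hcI hc using hV
    replace hc : ∀ v, (c v).1 = v := hc
    simp only [Finset.mem_biUnion, Finset.mem_univ, true_and, Fintype.mem_piFinset,
      Finset.mem_erase, and_true]
    refine ⟨fun v => (c v).2, ?_⟩
    rintro ⟨e, he⟩
    induction e using Sym2.ind with
    | _ u v =>
      intro hf
      refine hI (hcI u) (hcI v) ⟨by rw [hc, hc]; exact he, ?_⟩
      refine Eq.trans hf.symm ?_
      congr 2
      rw [hc, hc]
  have hcard := (Finset.card_le_card hcov).trans Finset.card_biUnion_le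
  simpa [Fintype.card_piFinset] using hcard

/-- If `x ≥ e` and `k log k ≥ x`, then `k ≥ x / log x`. -/
theorem div_log_le_of_le_mul_log {x k : ℝ} (hx : Real.exp 1 ≤ x) (hk : 0 < k)
    (h : x ≤ k * Real.log k) : x / Real.log x ≤ k := by
  have hx0 : 0 < x := (Real.exp_pos 1).trans_le hx
  have hlog : 1 ≤ Real.log x := (Real.le_log_iff_exp_le hx0).2 hx
  have hlog0 : 0 < Real.log x := one_pos.trans_le hlog
  rw [div_le_iff₀ hlog0]
  rcases le_total k x with hkx | hkx
  · exact h.trans (mul_le_mul_of_nonneg_left (Real.log_le_log hk hkx) hk.le)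
  · nlinarith

theorem CorrColorable.card_edgeSet_div_card_le {V : Type} [Fintype V] [Nonempty V]
    {G : SimpleGraph V} [Fintype G.edgeSet] {k : ℕ} (h : CorrColorable G k) :
    (Fintype.card G.edgeSet : ℝ) / Fintype.card V ≤ k * Real.log k := by
  have hk := h.pos
  have : NeZero k := ⟨hk.ne'⟩
  have hcount := h.pow_card_edgeSet_le
  set m := Fintype.card G.edgeSet
  have hn : (0 : ℝ) < Fintype.card V := Nat.cast_pos.2 Fintype.card_pos
  set n := Fintype.card V
  have hk0 : (0 : ℝ) < k := Nat.cast_pos.2 hk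
  have hreal : (k : ℝ) ^ m ≤ k ^ n * (k - 1 : ℝ) ^ m := by
    have : ((k ^ m : ℕ) : ℝ) ≤ ((k ^ n * (k - 1) ^ m : ℕ) : ℝ) := Nat.cast_le.2 hcount
    simpa [Nat.cast_sub hk] using this
  have hsub : (k - 1 : ℝ) ≤ k * Real.exp (-(1 / k)) := by
    have h1 := mul_le_mul_of_nonneg_left (Real.add_one_le_exp (-(1 / (k : ℝ)))) hk0.le
    have h2 : (k : ℝ) * (-(1 / k) + 1) = k - 1 := by field_simp; ring
    linarith
  have hk1 : (0 : ℝ) ≤ k - 1 := sub_nonneg.2 (Nat.one_le_cast.2 hk)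
  have hexp : (k : ℝ) ^ m * 1 ≤ k ^ m * (k ^ n * Real.exp (-(1 / k)) ^ m) := by
    calc (k : ℝ) ^ m * 1 ≤ k ^ n * (k - 1 : ℝ) ^ m := by rwa [mul_one]
      _ ≤ k ^ n * (k * Real.exp (-(1 / k))) ^ m := by gcongr
      _ = _ := by rw [mul_pow]; ring
  have hone := le_of_mul_le_mul_left hexp (pow_pos hk0 m)
  have hlog := Real.log_le_log one_pos hone
  rw [Real.log_one, Real.log_mul (by positivity) (by positivity), Real.log_pow, Real.log_pow,
    Real.log_exp] at hlog
  rw [div_le_iff₀ hn]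
  have hmul := mul_le_mul_of_nonneg_left hlog hk0.le
  have hm : (k : ℝ) * (m * -(1 / k)) = -m := by field_simp
  rw [mul_zero, mul_add, hm] at hmul
  linarith

/-- **Theorem 2 (lower bound).** If `G` is a finite simple graph with average degree
`d = 2|E(G)|/|V(G)| ≥ 2e`, then `χ_c(G) ≥ (d/2)/ln(d/2)`. -/
theorem corrChromaticNumber_lower_bound
    {V : Type} [Fintype V] (G : SimpleGraph V) [DecidableRel G.Adj]
    (d : ℝ) (hd : d = 2 * G.edgeFinset.card / Fintype.card V)
    (hde : 2 * Real.exp 1 ≤ d) :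
    d / 2 / Real.log (d / 2) ≤ (corrChromaticNumber G : ℝ) := by
  have hd0 : 0 < d := (mul_pos two_pos (Real.exp_pos 1)).trans_le hde
  have hcard : Fintype.card V ≠ 0 := by
    intro h
    simp [h] at hd
    linarith
  have : Nonempty V := Fintype.card_pos_iff.1 (Nat.pos_of_ne_zero hcard)
  have hcol : CorrColorable G (corrChromaticNumber G) :=
    Nat.sInf_mem (s := {k | CorrColorable G k}) ⟨_, corrColorable_card G⟩
  refine div_log_le_of_le_mul_log (by linarith) (Nat.cast_pos.2 hcol.pos) ?_
  have hhalf : d / 2 = (Fintype.card G.edgeSet : ℝ) / Fintype.card V := by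
    rw [hd, ← SimpleGraph.edgeFinset_card]
    ring
  rw [hhalf]
  exact hcol.card_edgeSet_div_card_le
end

section
/- Let G be a finite simple graph with average degree d := 2|E(G)|/|V(G)| ≥ 2e, and let k be a positive integer with k ≤ (d/2)/ln(d/2). Then there exists a cover (L,H) of G with |L(v)| = k for every vertex v such that G is not (L,H)-colorable. -/
open Classical Finset Real

/-- Derandomised union bound: the values of `σ` can be chosen one at a time so that every choice
eliminates at least a `1 / |K|` fraction of the remaining elements of `F`. -/
theorem exists_card_avoiding_mul_pow_le {F E K : Type*} [Fintype F] [Fintype K] [Nonempty K]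
    (g : F → E → K) (S : Finset E) :
    ∃ σ : E → K, #{f : F | ∀ e ∈ S, g f e ≠ σ e} * Fintype.card K ^ #S
      ≤ Fintype.card F * (Fintype.card K - 1) ^ #S := by
  induction S using Finset.induction_on with
  | empty => exact ⟨fun _ => Classical.arbitrary K, by simp⟩
  | insert e S he ih =>
    obtain ⟨σ, hσ⟩ := ih
    set A : Finset F := {f : F | ∀ e ∈ S, g f e ≠ σ e} with hA
    obtain ⟨c, hc⟩ : ∃ c : K, #A ≤ Fintype.card K * #{f ∈ A | g f e = c} := by
      by_contra! h
      have h1 : ∑ c : K, Fintype.card K * #{f ∈ A | g f e = c} < ∑ _c : K, #A :=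
        Finset.sum_lt_sum_of_nonempty Finset.univ_nonempty fun c _ => h c
      have h2 : #A = ∑ c : K, #{f ∈ A | g f e = c} :=
        Finset.card_eq_sum_card_fiberwise (f := fun f => g f e) (fun _ _ => by simp)
      rw [← Finset.mul_sum, ← h2] at h1
      simp at h1
    refine ⟨Function.update σ e c, ?_⟩
    have hB : ({f : F | ∀ e' ∈ insert e S, g f e' ≠ Function.update σ e c e'} : Finset F)
        = {f ∈ A | g f e ≠ c} := by
      ext f
      simp only [hA, Finset.mem_filter, Finset.mem_univ, true_and, Finset.forall_mem_insert,
        Function.update_self]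
      rw [and_comm]
      refine and_congr_left fun _ => forall₂_congr fun e' he' => ?_
      rw [Function.update_of_ne (ne_of_mem_of_not_mem he' he)]
    have hsplit := Finset.card_filter_add_card_filter_not (s := A) (fun f => g f e = c)
    have hpos : 0 < Fintype.card K := Fintype.card_pos
    rw [hB, Finset.card_insert_of_notMem he, pow_succ, pow_succ]
    obtain ⟨q, hq⟩ : ∃ q, Fintype.card K = q + 1 := ⟨Fintype.card K - 1, by omega⟩
    rw [hq] at hc hσ ⊢
    simp only [Nat.add_sub_cancel] at hσ ⊢
    have hle : #{f ∈ A | g f e ≠ c} * (q + 1) ≤ #A * q := by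
      simp only [ne_eq]
      nlinarith
    calc #{f ∈ A | g f e ≠ c} * ((q + 1) ^ #S * (q + 1))
        = (#{f ∈ A | g f e ≠ c} * (q + 1)) * (q + 1) ^ #S := by ring
      _ ≤ (#A * q) * (q + 1) ^ #S := Nat.mul_le_mul_right _ hle
      _ = (#A * (q + 1) ^ #S) * q := by ring
      _ ≤ (Fintype.card F * q ^ #S) * q := Nat.mul_le_mul_right _ hσ
      _ = _ := by ring

/-- The cover with lists `{v} × A` in which `(u, a)` and `(v, b)` are adjacent exactly when
`uv` is an edge and `a + b = σ uv`. -/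
def Cover.ofSum {V A : Type*} [AddCommGroup A] (G : SimpleGraph V) (σ : Sym2 V → A) :
    Cover G (V × A) where
  toFun := Prod.fst
  graph :=
    { Adj := fun x y => G.Adj x.1 y.1 ∧ x.2 + y.2 = σ s(x.1, y.1)
      symm := ⟨fun x y h => ⟨h.1.symm, by rw [add_comm, h.2, Sym2.eq_swap]⟩⟩
      loopless := ⟨fun x h => G.loopless.irrefl _ h.1⟩ }
  adj_map := fun _ _ h => h.1
  matching := fun x y y' h h' hy => by
    refine Prod.ext hy ?_
    have h1 := h.2
    rw [hy, ← h'.2] at h1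
    exact add_left_cancel h1

/-- The sum of the values of `f` at the two ends of an unordered pair. -/
def Sym2.sumOf {V A : Type*} [AddCommGroup A] (f : V → A) (e : Sym2 V) : A :=
  Sym2.lift ⟨fun u v => f u + f v, fun _ _ => add_comm _ _⟩ e

theorem Cover.exists_avoiding_of_colorable_ofSum {V A : Type*} [AddCommGroup A]
    {G : SimpleGraph V} {σ : Sym2 V → A} (h : (Cover.ofSum G σ).Colorable) :
    ∃ f : V → A, ∀ e ∈ G.edgeSet, Sym2.sumOf f e ≠ σ e := by
  obtain ⟨I, hI, hv⟩ := h
  have hv' : ∀ v, ∃ a, (v, a) ∈ I := fun v => by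
    obtain ⟨⟨u, a⟩, hx, rfl⟩ := hv v
    exact ⟨a, hx⟩
  choose f hf using hv'
  refine ⟨f, fun e => ?_⟩
  induction e with
  | h u v => exact fun he hs => hI (hf u) (hf v) ⟨he, hs⟩

/-- The strict inequality `k ^ n * (1 - 1 / k) ^ m < 1`, cleared of denominators. -/
theorem pow_mul_pred_pow_lt {n m k : ℕ} {x : ℝ} (hk : 0 < k) (hm : m ≠ 0)
    (hmx : (m : ℝ) = n * x) (hx : Real.exp 1 ≤ x) (hkx : (k : ℝ) ≤ x / Real.log x) :
    k ^ n * (k - 1) ^ m < k ^ m := by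
  have hx0 : 0 < x := (Real.exp_pos 1).trans_le hx
  have hlog : 1 ≤ Real.log x := (Real.le_log_iff_exp_le hx0).2 hx
  have hk0 : (0 : ℝ) < k := by exact_mod_cast hk
  have hklex : (k : ℝ) ≤ x := hkx.trans (div_le_self hx0.le hlog)
  have hlogk : Real.log k ≤ x / k := by
    refine (Real.log_le_log hk0 hklex).trans ?_
    rw [le_div_iff₀ (by linarith)] at hkx
    rw [le_div_iff₀ hk0]
    linarith
  have hpred : ((k - 1 : ℕ) : ℝ) < k * Real.exp (-(1 / k)) := by
    have h := Real.add_one_lt_exp (x := -(1 / (k : ℝ))) (by simp [hk.ne'])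
    have h' := mul_lt_mul_of_pos_left h hk0
    rw [Nat.cast_sub hk]
    refine lt_of_eq_of_lt ?_ h'
    field_simp
    push_cast
    ring
  have hpow : ((k - 1 : ℕ) : ℝ) ^ m < k ^ m * Real.exp (-(n * (x / k))) := by
    refine (pow_lt_pow_left₀ hpred (Nat.cast_nonneg _) hm).trans_eq ?_
    rw [mul_pow, ← Real.exp_nat_mul, hmx]
    congr 2
    ring
  have hkn : (k : ℝ) ^ n ≤ Real.exp (n * (x / k)) := by
    rw [← Real.exp_log hk0, ← Real.exp_nat_mul, Real.exp_log hk0]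
    gcongr
  have key : (k : ℝ) ^ n * ((k - 1 : ℕ) : ℝ) ^ m < k ^ m := by
    calc (k : ℝ) ^ n * ((k - 1 : ℕ) : ℝ) ^ m
        < k ^ n * (k ^ m * Real.exp (-(n * (x / k)))) := by gcongr
      _ ≤ Real.exp (n * (x / k)) * (k ^ m * Real.exp (-(n * (x / k)))) := by gcongr
      _ = k ^ m := by rw [mul_left_comm, ← Real.exp_add]; simp
  exact_mod_cast key

/-- If `G` has average degree `d = 2|E(G)|/|V(G)| ≥ 2e` and `k` is a positive integer with
`k ≤ (d/2)/ln(d/2)`, then there is a cover `(L,H)` of `G` with all lists of size exactly `k`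
for which `G` is not `(L,H)`-colorable. -/
theorem exists_noncolorable_cover
    {V : Type} [Fintype V] (G : SimpleGraph V) [DecidableRel G.Adj]
    (d : ℝ) (hd : d = 2 * G.edgeFinset.card / Fintype.card V)
    (hde : 2 * Real.exp 1 ≤ d)
    (k : ℕ) (hk : 0 < k) (hkd : (k : ℝ) ≤ d / 2 / Real.log (d / 2)) :
    ∃ (W : Type) (_ : Fintype W) (C : Cover G W),
      (∀ v : V, Fintype.card {x : W // C.toFun x = v} = k) ∧ ¬ C.Colorable := by
  have he := Real.exp_pos 1
  have hn : (Fintype.card V : ℝ) ≠ 0 := fun h => by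
    rw [h, div_zero] at hd
    linarith
  have hmx : (#G.edgeFinset : ℝ) = Fintype.card V * (d / 2) := by
    rw [hd]
    field_simp
  have hm : #G.edgeFinset ≠ 0 := fun h => by
    rw [h] at hd
    simp only [Nat.cast_zero, mul_zero, zero_div] at hd
    linarith
  have hlt := pow_mul_pred_pow_lt hk hm hmx (by linarith) hkd
  have : NeZero k := ⟨hk.ne'⟩
  obtain ⟨σ, hσ⟩ := exists_card_avoiding_mul_pow_le
    (Sym2.sumOf (V := V) (A := ZMod k)) G.edgeFinset
  refine ⟨V × ZMod k, instFintypeProd _ _, Cover.ofSum G σ, fun v => ?_, fun hcol => ?_⟩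
  · have e : {x : V × ZMod k // (Cover.ofSum G σ).toFun x = v} ≃ ZMod k :=
      { toFun := fun x => x.1.2
        invFun := fun a => ⟨(v, a), rfl⟩
        left_inv := by rintro ⟨⟨u, a⟩, rfl⟩; rfl
        right_inv := fun _ => rfl }
    rw [Fintype.card_congr e, ZMod.card]
  · obtain ⟨f, hf⟩ := Cover.exists_avoiding_of_colorable_ofSum hcol
    rw [ZMod.card, Fintype.card_fun, ZMod.card] at hσ
    refine hlt.not_ge (le_trans (Nat.le_mul_of_pos_left _ (Finset.card_pos.2 ⟨f, ?_⟩)) hσ)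
    simpa using hf
end

section
/- There exists a constant Δ₀ such that for every Δ ≥ Δ₀ and every finite simple triangle-free graph G with maximum degree at most Δ, the correspondence chromatic number of G satisfies χ_c(G) ≤ ⌈120Δ/ln Δ⌉. -/
open Classical Finset Real

theorem Finset.card_filter_le_mul_of_fiberwise {α β : Type*} (s : Finset α) (r : α → β)
    (p : α → Prop) (q : ℝ)
    (h : ∀ a ∈ s, (#{b ∈ s | r b = r a ∧ p b} : ℝ) ≤ q * #{b ∈ s | r b = r a}) :
    (#{a ∈ s | p a} : ℝ) ≤ q * #s := by
  have h₁ : #s = ∑ b ∈ s.image r, #{a ∈ s | r a = b} :=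
    card_eq_sum_card_image r s
  have h₂ : #{a ∈ s | p a} = ∑ b ∈ s.image r, #{a ∈ s | r a = b ∧ p a} := by
    rw [card_eq_sum_card_fiberwise (f := r) (t := s.image r)]
    · refine sum_congr rfl fun b _ => ?_
      rw [filter_filter]
      simp only [and_comm]
    · intro a ha
      simp only [coe_filter, Set.mem_ofPred_eq] at ha
      exact mem_coe.2 (mem_image_of_mem r ha.1)
  rw [h₁, h₂]
  push_cast
  rw [mul_sum]
  refine sum_le_sum fun b hb => ?_
  obtain ⟨a, ha, rfl⟩ := mem_image.1 hb
  exact h a ha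

/-- The symmetric lopsided local lemma for the uniform measure on a finite set. -/
theorem exists_forall_not_of_lopsided {α ι : Type*} [Fintype ι] (Ω : Finset α)
    (hΩ : Ω.Nonempty) (B : ι → α → Prop) (Γ : ι → Finset ι) (D : ℕ) (q : ℝ) (hq : 0 ≤ q)
    (hΓ : ∀ i, #(Γ i) ≤ D) (hD : 1 ≤ D) (hqD : 4 * D * q ≤ 1)
    (h : ∀ i (A : Finset ι), Disjoint A (Γ i) →
      (#{a ∈ Ω | (∀ j ∈ A, ¬ B j a) ∧ B i a} : ℝ) ≤ q * #{a ∈ Ω | ∀ j ∈ A, ¬ B j a}) :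
    ∃ a ∈ Ω, ∀ i, ¬ B i a := by
  have key : ∀ n (A : Finset ι), #A = n → ∀ i,
      (#{a ∈ Ω | (∀ j ∈ A, ¬ B j a) ∧ B i a} : ℝ) ≤ 2 * q * #{a ∈ Ω | ∀ j ∈ A, ¬ B j a} := by
    intro n
    induction n using Nat.strong_induction_on with
    | _ n ih =>
      intro A hA i
      set A' := A \ Γ i with hA'
      have h₁ := h i A' sdiff_disjoint
      have h₂ : (#{a ∈ Ω | (∀ j ∈ A, ¬ B j a) ∧ B i a} : ℝ)
          ≤ #{a ∈ Ω | (∀ j ∈ A', ¬ B j a) ∧ B i a} := by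
        refine Nat.cast_le.2 (card_le_card fun a ha => ?_)
        simp only [mem_filter] at ha ⊢
        exact ⟨ha.1, fun j hj => ha.2.1 j (mem_sdiff.1 hj).1, ha.2.2⟩
      have h₃ : (#{a ∈ Ω | ∀ j ∈ A', ¬ B j a} : ℝ) ≤ 2 * #{a ∈ Ω | ∀ j ∈ A, ¬ B j a} := by
        rcases (A ∩ Γ i).eq_empty_or_nonempty with he | hne
        · have : A' = A := sdiff_eq_self_iff_disjoint.2 (disjoint_iff_inter_eq_empty.2 he)
          rw [this]
          linarith [(Nat.cast_nonneg (#{a ∈ Ω | ∀ j ∈ A, ¬ B j a}) : (0 : ℝ) ≤ _)]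
        · have hlt : #A' < n := by
            have : #A' + #(A ∩ Γ i) = #A := card_sdiff_add_card_inter A (Γ i)
            have := hne.card_pos
            omega
          have hcov : {a ∈ Ω | ∀ j ∈ A', ¬ B j a} ⊆ {a ∈ Ω | ∀ j ∈ A, ¬ B j a} ∪
              (A ∩ Γ i).biUnion fun j => {a ∈ Ω | (∀ j ∈ A', ¬ B j a) ∧ B j a} := by
            intro a ha
            simp only [mem_filter, mem_union, mem_biUnion, mem_inter] at ha ⊢
            by_cases hB : ∀ j ∈ A, ¬ B j a
            · exact Or.inl ⟨ha.1, hB⟩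
            · push Not at hB
              obtain ⟨j, hj, hjB⟩ := hB
              refine Or.inr ⟨j, ⟨hj, ?_⟩, ha.1, ha.2, hjB⟩
              by_contra hjΓ
              exact ha.2 j (mem_sdiff.2 ⟨hj, hjΓ⟩) hjB
          have hsum : (#{a ∈ Ω | ∀ j ∈ A', ¬ B j a} : ℝ) ≤ #{a ∈ Ω | ∀ j ∈ A, ¬ B j a} +
              ∑ j ∈ A ∩ Γ i, (#{a ∈ Ω | (∀ j ∈ A', ¬ B j a) ∧ B j a} : ℝ) := by
            exact_mod_cast (card_le_card hcov).trans
              ((card_union_le _ _).trans (Nat.add_le_add_left card_biUnion_le _))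
          have hsum' : ∑ j ∈ A ∩ Γ i, (#{a ∈ Ω | (∀ j ∈ A', ¬ B j a) ∧ B j a} : ℝ) ≤
              D * (2 * q * #{a ∈ Ω | ∀ j ∈ A', ¬ B j a}) := by
            refine (sum_le_card_nsmul _ _ _ fun j _ => ih _ hlt A' rfl j).trans ?_
            rw [nsmul_eq_mul]
            have : (#(A ∩ Γ i) : ℝ) ≤ D :=
              Nat.cast_le.2 ((card_le_card inter_subset_right).trans (hΓ i))
            gcongr
          have := mul_le_mul_of_nonneg_right hqD
            (Nat.cast_nonneg (#{a ∈ Ω | ∀ j ∈ A', ¬ B j a}) : (0 : ℝ) ≤ _)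
          linarith
      have := mul_le_mul_of_nonneg_left h₃ hq
      linarith
  have hq2 : 2 * q ≤ 1 / 2 := by
    have : (1 : ℝ) ≤ D := by exact_mod_cast hD
    nlinarith
  have pos : ∀ A : Finset ι, 0 < #{a ∈ Ω | ∀ j ∈ A, ¬ B j a} := by
    intro A
    induction A using Finset.induction_on with
    | empty => simpa using hΩ.card_pos
    | insert i A _ ih =>
      have h₁ := key _ A rfl i
      have h₂ : #{a ∈ Ω | ∀ j ∈ A, ¬ B j a} =
          #{a ∈ Ω | (∀ j ∈ A, ¬ B j a) ∧ B i a} + #{a ∈ Ω | ∀ j ∈ insert i A, ¬ B j a} := by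
        rw [← card_filter_add_card_filter_not (s := {a ∈ Ω | ∀ j ∈ A, ¬ B j a}) (B i),
          filter_filter, filter_filter]
        congr 2
        ext a
        simp only [mem_filter, forall_mem_insert]
        tauto
      by_contra h0
      have h0' : #{a ∈ Ω | ∀ j ∈ insert i A, ¬ B j a} = 0 := by omega
      rw [h0', add_zero] at h₂
      rw [← h₂] at h₁
      have : (0 : ℝ) < #{a ∈ Ω | ∀ j ∈ A, ¬ B j a} := by exact_mod_cast ih
      nlinarith
  obtain ⟨a, ha⟩ := card_pos.1 (pos univ)
  rw [mem_filter] at ha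
  exact ⟨a, ha.1, fun i => ha.2 i (mem_univ i)⟩

theorem Finset.two_pow_mul_card_piFinset_filter_le {ι κ : Type*} [Fintype ι]
    (t : ι → Finset κ) (P R : ι → κ → Prop)
    (h : ∀ i, #{j ∈ t i | P i j} ≤ #{j ∈ t i | R i j}) (m : ℕ) :
    2 ^ m * #{g ∈ Fintype.piFinset t | (∀ i, ¬ R i (g i)) ∧ m ≤ #{i | P i (g i)}} ≤
      #(Fintype.piFinset t) := by
  set w : ι → κ → ℕ := fun i j => if R i j then 0 else if P i j then 2 else 1 with hw
  have hsum : ∀ i, ∑ j ∈ t i, w i j ≤ #(t i) := by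
    intro i
    have h₁ : ∑ j ∈ t i, w i j + #{j ∈ t i | R i j} ≤ #(t i) + #{j ∈ t i | P i j} := by
      rw [card_filter, card_filter, card_eq_sum_ones, ← sum_add_distrib, ← sum_add_distrib]
      refine sum_le_sum fun j _ => ?_
      simp only [hw]
      split_ifs <;> simp
    have := h i
    omega
  calc 2 ^ m * #{g ∈ Fintype.piFinset t | (∀ i, ¬ R i (g i)) ∧ m ≤ #{i | P i (g i)}}
      = ∑ g ∈ Fintype.piFinset t with (∀ i, ¬ R i (g i)) ∧ m ≤ #{i | P i (g i)}, 2 ^ m := by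
        rw [sum_const, smul_eq_mul, mul_comm]
    _ ≤ ∑ g ∈ Fintype.piFinset t with (∀ i, ¬ R i (g i)) ∧ m ≤ #{i | P i (g i)},
          ∏ i, w i (g i) := by
        refine sum_le_sum fun g hg => ?_
        obtain ⟨-, hR, hm⟩ := mem_filter.1 hg
        have : ∏ i, w i (g i) = 2 ^ #{i | P i (g i)} := by
          rw [← prod_const, prod_filter]
          exact prod_congr rfl fun i _ => by simp [hw, hR i]
        rw [this]
        exact Nat.pow_le_pow_right two_pos hm
    _ ≤ ∑ g ∈ Fintype.piFinset t, ∏ i, w i (g i) :=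
        sum_le_sum_of_subset (filter_subset _ _)
    _ = ∏ i, ∑ j ∈ t i, w i j := (prod_univ_sum t w).symm
    _ ≤ ∏ i, #(t i) := prod_le_prod' fun i _ => hsum i
    _ = #(Fintype.piFinset t) := (Fintype.card_piFinset t).symm

theorem Finset.sum_piFinset_sum_update {ι κ : Type*} [Fintype ι] (t : ι → Finset κ)
    (a : ι) (F : (ι → κ) → ℝ) :
    ∑ g ∈ Fintype.piFinset t, ∑ j ∈ t a, F (Function.update g a j) =
      #(t a) * ∑ g ∈ Fintype.piFinset t, F g := by
  have hup : ∀ g ∈ Fintype.piFinset t, ∀ j ∈ t a, Function.update g a j ∈ Fintype.piFinset t := by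
    intro g hg j hj
    rw [Fintype.mem_piFinset] at hg ⊢
    intro i
    rcases eq_or_ne i a with rfl | hi
    · simpa using hj
    · simpa [hi] using hg i
  calc ∑ g ∈ Fintype.piFinset t, ∑ j ∈ t a, F (Function.update g a j)
      = ∑ x ∈ Fintype.piFinset t ×ˢ t a, F (Function.update x.1 a x.2) := by
        rw [sum_product]
    _ = ∑ x ∈ Fintype.piFinset t ×ˢ t a, F x.1 := by
        refine sum_nbij' (fun x => (Function.update x.1 a x.2, x.1 a))
          (fun x => (Function.update x.1 a x.2, x.1 a)) ?_ ?_ ?_ ?_ ?_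
        · intro x hx
          rw [mem_product] at hx ⊢
          exact ⟨hup _ hx.1 _ hx.2, Fintype.mem_piFinset.1 hx.1 a⟩
        · intro x hx
          rw [mem_product] at hx ⊢
          exact ⟨hup _ hx.1 _ hx.2, Fintype.mem_piFinset.1 hx.1 a⟩
        · intro x _
          simp
        · intro x _
          simp
        · intro x _
          simp
    _ = #(t a) * ∑ g ∈ Fintype.piFinset t, F g := by
        rw [sum_product, mul_sum]
        simp

theorem Finset.sum_prod_one_sub_le_of_disjoint {κ X : Type*} (t : Finset κ) (A : Finset X)
    (R : X → κ → Prop) (hR : ∀ j ∈ t, ∀ x ∈ A, ∀ y ∈ A, R x j → R y j → x = y)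
    (h : X → ℝ) (h0 : ∀ x, 0 ≤ h x) (h1 : ∀ x, h x ≤ 1) (ht : t.Nonempty) :
    ∑ j ∈ t, ∏ x ∈ A, (1 - h x * if R x j then 0 else 1) ≤
      #t * ∏ x ∈ A, (1 - h x * (1 - #{j ∈ t | R x j} / #t)) := by
  have htc : (0 : ℝ) < #t := by exact_mod_cast ht.card_pos
  induction A using Finset.induction_on with
  | empty => simp
  | insert y A hy ih =>
    have ih := ih fun j hj x hx z hz => hR j hj x (mem_insert_of_mem hx) z (mem_insert_of_mem hz)
    set Z : κ → ℝ := fun j => ∏ x ∈ A, (1 - h x * if R x j then 0 else 1) with hZ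
    set ρ : ℝ := ∏ x ∈ A, (1 - h x) with hρ
    have hZρ : ∀ j ∈ t, ρ ≤ Z j := fun j _ => prod_le_prod (fun x _ => by linarith [h1 x])
      fun x _ => by split_ifs <;> linarith [h0 x]
    have hZy : ∀ j ∈ t, R y j → Z j = ρ := by
      intro j hj hyj
      refine prod_congr rfl fun x hx => ?_
      have : ¬ R x j := fun hxj => hy
        (hR j hj x (mem_insert_of_mem hx) y (mem_insert_self y A) hxj hyj ▸ hx)
      simp [this]
    have hsplit : ∑ j ∈ t, ∏ x ∈ insert y A, (1 - h x * if R x j then 0 else 1) =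
        (1 - h y) * ∑ j ∈ t, Z j + h y * (#{j ∈ t | R y j} * ρ) := by
      have : (#{j ∈ t | R y j} : ℝ) * ρ = ∑ j ∈ t, if R y j then Z j else 0 := by
        rw [← sum_filter, sum_congr rfl fun j hj =>
          hZy j (mem_filter.1 hj).1 (mem_filter.1 hj).2, sum_const, nsmul_eq_mul]
      rw [this, mul_sum, mul_sum, ← sum_add_distrib]
      refine sum_congr rfl fun j _ => ?_
      rw [prod_insert hy]
      change _ * Z j = _
      split_ifs <;> ring
    have hρle : #t * ρ ≤ ∑ j ∈ t, Z j := by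
      rw [← nsmul_eq_mul]
      exact card_nsmul_le_sum t Z ρ hZρ
    have hp1 : (#{j ∈ t | R y j} : ℝ) / #t ≤ 1 :=
      div_le_one_of_le₀ (Nat.cast_le.2 (card_filter_le _ _)) htc.le
    have hp0 : (0 : ℝ) ≤ (#{j ∈ t | R y j} : ℝ) / #t := by positivity
    rw [hsplit, prod_insert hy]
    set p : ℝ := (#{j ∈ t | R y j} : ℝ) / #t with hp
    have hpt : (#{j ∈ t | R y j} : ℝ) = p * #t := by rw [hp]; field_simp
    have hyp : 0 ≤ h y * p := mul_nonneg (h0 y) hp0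
    have hpos : 0 ≤ 1 - h y * (1 - p) := by
      nlinarith [h0 y, h1 y]
    calc (1 - h y) * ∑ j ∈ t, Z j + h y * (#{j ∈ t | R y j} * ρ)
        = (1 - h y) * ∑ j ∈ t, Z j + h y * p * (#t * ρ) := by rw [hpt]; ring
      _ ≤ (1 - h y) * ∑ j ∈ t, Z j + h y * p * ∑ j ∈ t, Z j := by gcongr
      _ = (1 - h y * (1 - p)) * ∑ j ∈ t, Z j := by ring
      _ ≤ (1 - h y * (1 - p)) * (#t * ∏ x ∈ A, (1 - h x * (1 - #{j ∈ t | R x j} / #t))) :=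
          mul_le_mul_of_nonneg_left ih hpos
      _ = _ := by ring

theorem Finset.sum_piFinset_prod_one_sub_le {ι κ X : Type*} [Fintype ι] (t : ι → Finset κ)
    (ht : ∀ i, (t i).Nonempty) (S : Finset ι) (A : Finset X) (R : X → κ → Prop)
    (hR : ∀ i, ∀ j ∈ t i, ∀ x ∈ A, ∀ y ∈ A, R x j → R y j → x = y)
    (h : X → ℝ) (h0 : ∀ x, 0 ≤ h x) (h1 : ∀ x, h x ≤ 1) :
    ∑ g ∈ Fintype.piFinset t, ∏ x ∈ A, (1 - h x * ∏ i ∈ S, if R x (g i) then 0 else 1) ≤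
      #(Fintype.piFinset t) *
        ∏ x ∈ A, (1 - h x * ∏ i ∈ S, (1 - (#{j ∈ t i | R x j} : ℝ) / #(t i))) := by
  induction S using Finset.induction_on generalizing h with
  | empty => simp
  | insert a S ha ih =>
    have hta : (0 : ℝ) < #(t a) := by exact_mod_cast (ht a).card_pos
    have hp1 : ∀ x, (#{j ∈ t a | R x j} : ℝ) / #(t a) ≤ 1 := fun x =>
      div_le_one_of_le₀ (Nat.cast_le.2 (card_filter_le _ _)) hta.le
    have hp0 : ∀ x, (0 : ℝ) ≤ (#{j ∈ t a | R x j} : ℝ) / #(t a) := fun x => by positivity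
    have hU0 : ∀ (g : ι → κ) x, (0 : ℝ) ≤ ∏ i ∈ S, if R x (g i) then 0 else 1 := fun g x =>
      prod_nonneg fun i _ => by split_ifs <;> norm_num
    have hU1 : ∀ (g : ι → κ) x, ∏ i ∈ S, (if R x (g i) then (0 : ℝ) else 1) ≤ 1 := fun g x =>
      prod_le_one (fun i _ => by split_ifs <;> norm_num) fun i _ => by split_ifs <;> norm_num
    have step := ih (fun x => h x * (1 - #{j ∈ t a | R x j} / #(t a)))
      (fun x => mul_nonneg (h0 x) (by linarith [hp1 x]))
      (fun x => mul_le_one₀ (h1 x) (by linarith [hp1 x]) (by linarith [hp0 x]))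
    have hav : ∑ g ∈ Fintype.piFinset t,
        ∏ x ∈ A, (1 - h x * ∏ i ∈ insert a S, if R x (g i) then 0 else 1) ≤
        ∑ g ∈ Fintype.piFinset t, ∏ x ∈ A, (1 - h x * (1 - #{j ∈ t a | R x j} / #(t a)) *
          ∏ i ∈ S, if R x (g i) then 0 else 1) := by
      refine le_of_mul_le_mul_left ?_ hta
      rw [← sum_piFinset_sum_update t a, mul_sum]
      refine sum_le_sum fun g _ => ?_
      have h₁ := sum_prod_one_sub_le_of_disjoint (t a) A R (hR a)
        (fun x => h x * ∏ i ∈ S, if R x (g i) then 0 else 1)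
        (fun x => mul_nonneg (h0 x) (hU0 g x))
        (fun x => mul_le_one₀ (h1 x) (hU0 g x) (hU1 g x)) (ht a)
      calc _ = _ := sum_congr rfl fun j _ => prod_congr rfl fun x _ => ?_
        _ ≤ _ := h₁
        _ = _ := congrArg _ (prod_congr rfl fun x _ => by ring)
      rw [prod_insert ha, Function.update_self]
      have : ∏ i ∈ S, (if R x (Function.update g a j i) then (0 : ℝ) else 1) =
          ∏ i ∈ S, if R x (g i) then 0 else 1 := prod_congr rfl fun i hi => by
        rw [Function.update_of_ne (ne_of_mem_of_not_mem hi ha)]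
      rw [this]
      ring
    refine hav.trans (step.trans_eq ?_)
    congr 1
    refine prod_congr rfl fun x _ => ?_
    rw [prod_insert ha, mul_assoc]

theorem Real.exp_neg_two_mul_le_one_sub {p : ℝ} (h0 : 0 ≤ p) (hp : p ≤ 1 / 2) :
    exp (-(2 * p)) ≤ 1 - p := by
  rw [Real.exp_neg]
  refine inv_le_of_inv_le₀ (by linarith) ?_
  refine le_trans ?_ (Real.add_one_le_exp (2 * p))
  rw [inv_le_iff_one_le_mul₀ (by linarith)]
  nlinarith

theorem Finset.card_mul_exp_le_sum_exp {X : Type*} (A : Finset X) (s : X → ℝ) (σ : ℝ)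
    (hs : ∑ x ∈ A, s x ≤ σ) : #A * exp (-(σ / #A)) ≤ ∑ x ∈ A, exp (-s x) := by
  rcases A.eq_empty_or_nonempty with rfl | hA
  · simp
  have hA : (0 : ℝ) < #A := by exact_mod_cast hA.card_pos
  calc #A * exp (-(σ / #A))
      ≤ exp (-(σ / #A)) * (#A + σ - ∑ x ∈ A, s x) := by
        rw [mul_comm]
        gcongr
        linarith
    _ = ∑ x ∈ A, exp (-(σ / #A)) * (1 + σ / #A - s x) := by
        rw [← mul_sum, sum_sub_distrib, sum_const, nsmul_eq_mul]
        congr 1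
        field_simp
    _ ≤ ∑ x ∈ A, exp (-s x) := by
        refine sum_le_sum fun x _ => ?_
        have h₁ := Real.add_one_le_exp (σ / #A - s x)
        calc exp (-(σ / #A)) * (1 + σ / #A - s x)
            ≤ exp (-(σ / #A)) * exp (σ / #A - s x) := by gcongr; linarith
          _ = exp (-s x) := by rw [← Real.exp_add]; congr 1; ring

theorem Finset.card_piFinset_filter_few_unhit_le {ι κ X : Type*} [Fintype ι]
    (t : ι → Finset κ) (ht : ∀ i, (t i).Nonempty) (S : Finset ι) (A : Finset X)
    (R : X → κ → Prop) (hR : ∀ i, ∀ j ∈ t i, ∀ x ∈ A, ∀ y ∈ A, R x j → R y j → x = y)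
    (hhalf : ∀ i, ∀ x ∈ A, 2 * #{j ∈ t i | R x j} ≤ #(t i)) (m : ℕ) :
    (#{g ∈ Fintype.piFinset t | #{x ∈ A | ∀ i ∈ S, ¬ R x (g i)} < m} : ℝ) ≤
      2 ^ m * exp (-(#A / 2 * exp (-(2 * #S / #A)))) * #(Fintype.piFinset t) := by
  set p : X → ι → ℝ := fun x i => (#{j ∈ t i | R x j} : ℝ) / #(t i) with hp
  have htc : ∀ i, (0 : ℝ) < #(t i) := fun i => by exact_mod_cast (ht i).card_pos
  have hp0 : ∀ x i, 0 ≤ p x i := fun x i => by positivity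
  have hp2 : ∀ x ∈ A, ∀ i, p x i ≤ 1 / 2 := by
    intro x hx i
    rw [hp, div_le_iff₀ (htc i)]
    have : (2 * #{j ∈ t i | R x j} : ℝ) ≤ #(t i) := by exact_mod_cast hhalf i x hx
    linarith
  have hsum : ∑ x ∈ A, ∑ i ∈ S, 2 * p x i ≤ 2 * #S := by
    rw [sum_comm, mul_comm, ← nsmul_eq_mul]
    refine sum_le_card_nsmul _ _ _ fun i _ => ?_
    rw [← mul_sum]
    have h₁ : ∑ x ∈ A, #{j ∈ t i | R x j} ≤ #(t i) := by
      rw [← card_biUnion]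
      · exact card_le_card (biUnion_subset.2 fun x _ => filter_subset _ _)
      · intro x hx y hy hxy
        rw [Function.onFun, disjoint_left]
        intro j hj hj'
        rw [mem_filter] at hj hj'
        exact hxy (hR i j hj.1 x hx y hy hj.2 hj'.2)
    have h₂ : ∑ x ∈ A, p x i ≤ 1 := by
      rw [hp, ← sum_div]
      refine div_le_one_of_le₀ ?_ (htc i).le
      exact_mod_cast h₁
    linarith
  have hE : #A * exp (-(2 * #S / #A)) ≤ ∑ x ∈ A, ∏ i ∈ S, (1 - p x i) := by
    refine (card_mul_exp_le_sum_exp A _ _ hsum).trans (sum_le_sum fun x hx => ?_)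
    rw [← sum_neg_distrib, Real.exp_sum]
    exact prod_le_prod (fun i _ => (Real.exp_pos _).le) fun i _ =>
      Real.exp_neg_two_mul_le_one_sub (hp0 x i) (hp2 x hx i)
  have hneg := sum_piFinset_prod_one_sub_le t ht S A R hR (fun _ => 1 / 2)
    (fun _ => by norm_num) (fun _ => by norm_num)
  have hprod : ∏ x ∈ A, (1 - 1 / 2 * ∏ i ∈ S, (1 - p x i)) ≤
      exp (-(#A / 2 * exp (-(2 * #S / #A)))) := by
    calc ∏ x ∈ A, (1 - 1 / 2 * ∏ i ∈ S, (1 - p x i))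
        ≤ ∏ x ∈ A, exp (-(1 / 2 * ∏ i ∈ S, (1 - p x i))) := by
          refine prod_le_prod (fun x hx => ?_) fun x _ => Real.one_sub_le_exp_neg _
          have : ∏ i ∈ S, (1 - p x i) ≤ 1 :=
            prod_le_one (fun i _ => by linarith [hp2 x hx i]) fun i _ => by linarith [hp0 x i]
          linarith
      _ = exp (-(1 / 2 * ∑ x ∈ A, ∏ i ∈ S, (1 - p x i))) := by
          rw [← Real.exp_sum, sum_neg_distrib, mul_sum]
      _ ≤ _ := by
          rw [Real.exp_le_exp]
          linarith
  have hweight : ∀ g : ι → κ, ∏ x ∈ A, (1 - 1 / 2 * ∏ i ∈ S, if R x (g i) then (0 : ℝ) else 1) =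
      (1 / 2) ^ #{x ∈ A | ∀ i ∈ S, ¬ R x (g i)} := by
    intro g
    rw [← prod_const, prod_filter]
    refine prod_congr rfl fun x _ => ?_
    split_ifs with hx
    · rw [prod_congr rfl fun i hi => if_neg (hx i hi)]
      norm_num
    · push Not at hx
      obtain ⟨i, hi, hRi⟩ := hx
      rw [prod_eq_zero (f := fun i => if R x (g i) then (0 : ℝ) else 1) hi (if_pos hRi)]
      norm_num
  have hmarkov : (#{g ∈ Fintype.piFinset t | #{x ∈ A | ∀ i ∈ S, ¬ R x (g i)} < m} : ℝ) *
      (1 / 2) ^ m ≤ ∑ g ∈ Fintype.piFinset t,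
        ∏ x ∈ A, (1 - 1 / 2 * ∏ i ∈ S, if R x (g i) then (0 : ℝ) else 1) := by
    rw [← nsmul_eq_mul]
    refine (card_nsmul_le_sum _ (fun g => (1 / 2 : ℝ) ^ #{x ∈ A | ∀ i ∈ S, ¬ R x (g i)}) _
      fun g hg => ?_).trans ?_
    · exact pow_le_pow_of_le_one (by norm_num) (by norm_num) (mem_filter.1 hg).2.le
    · simp only [hweight]
      exact sum_le_sum_of_subset_of_nonneg (filter_subset _ _) fun _ _ _ => by positivity
  have h2m : (2 : ℝ) ^ m * (1 / 2) ^ m = 1 := by rw [← mul_pow]; norm_num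
  have hfin := hmarkov.trans (hneg.trans (mul_le_mul_of_nonneg_left hprod (Nat.cast_nonneg _)))
  have := mul_le_mul_of_nonneg_left hfin (show (0 : ℝ) ≤ 2 ^ m by positivity)
  calc (#{g ∈ Fintype.piFinset t | #{x ∈ A | ∀ i ∈ S, ¬ R x (g i)} < m} : ℝ)
      = 2 ^ m * (#{g ∈ Fintype.piFinset t | #{x ∈ A | ∀ i ∈ S, ¬ R x (g i)} < m} *
          (1 / 2) ^ m) := by rw [mul_left_comm, h2m, mul_one]
    _ ≤ _ := this
    _ = _ := by ring

theorem SimpleGraph.CliqueFree.not_adj_of_adj {V : Type*} {G : SimpleGraph V}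
    (hG : G.CliqueFree 3) {u v w : V} (hu : G.Adj v u) (hw : G.Adj v w) : ¬ G.Adj u w :=
  fun h => hG {v, u, w} (SimpleGraph.is3Clique_triple_iff.2 ⟨hu, hw, h⟩)

namespace Cover

variable {V W : Type*} {G : SimpleGraph V} (C : Cover G W) (L : V → Finset W)

/-- A partial coloring from the lists `L`; `none` marks an uncolored vertex. -/
structure IsPartial (f : V → Option W) : Prop where
  mem : ∀ ⦃v x⦄, f v = some x → x ∈ L v
  indep : ∀ ⦃u v x y⦄, f u = some x → f v = some y → ¬ C.graph.Adj x y

/-- The colors of `L v` not in conflict with the partial coloring `f`. -/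
noncomputable def avail (f : V → Option W) (v : V) : Finset W :=
  {x ∈ L v | ∀ u y, f u = some y → ¬ C.graph.Adj x y}

/-- The uncolored vertices at which the color `x` conflicts with an available color. -/
noncomputable def conflicts [Fintype V] (f : V → Option W) (x : W) : Finset V :=
  {u | f u = none ∧ ∃ y ∈ C.avail L f u, C.graph.Adj x y}

/-- A vertex with few available colors or an available color in many conflicts. -/
def Bad [Fintype V] (m : ℕ) (f : V → Option W) (v : V) : Prop :=
  #(C.avail L f v) < 4 * m ∨ ∃ x ∈ C.avail L f v, m ≤ #(C.conflicts L f x)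

variable {C L}

theorem mem_avail {f : V → Option W} {v : V} {x : W} :
    x ∈ C.avail L f v ↔ x ∈ L v ∧ ∀ u y, f u = some y → ¬ C.graph.Adj x y := by
  simp [avail]

theorem mem_conflicts [Fintype V] {f : V → Option W} {u : V} {x : W} :
    u ∈ C.conflicts L f x ↔ f u = none ∧ ∃ y ∈ C.avail L f u, C.graph.Adj x y := by
  simp [conflicts]

theorem adj_of_mem (hL : ∀ v, ∀ x ∈ L v, C.toFun x = v) {u v : V} {x y : W} (hx : x ∈ L u)
    (hy : y ∈ L v) (h : C.graph.Adj x y) : G.Adj u v := by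
  have := C.adj_map h
  rwa [hL u x hx, hL v y hy] at this

theorem eq_of_adj (hL : ∀ v, ∀ x ∈ L v, C.toFun x = v) {v : V} {x y y' : W} (hy : y ∈ L v)
    (hy' : y' ∈ L v) (h : C.graph.Adj x y) (h' : C.graph.Adj x y') : y = y' :=
  C.matching h h' ((hL v y hy).trans (hL v y' hy').symm)

theorem avail_congr (hL : ∀ v, ∀ x ∈ L v, C.toFun x = v) {f g : V → Option W} {v : V}
    (hf : C.IsPartial L f) (hg : C.IsPartial L g) (h : ∀ u, G.Adj v u → f u = g u) :
    C.avail L f v = C.avail L g v := by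
  have key : ∀ {f g : V → Option W}, C.IsPartial L g → (∀ u, G.Adj v u → f u = g u) →
      C.avail L f v ⊆ C.avail L g v := by
    intro f g hg h x hx
    rw [mem_avail] at hx ⊢
    refine ⟨hx.1, fun u y hu hxy => ?_⟩
    exact hx.2 u y ((h u (adj_of_mem hL hx.1 (hg.mem hu) hxy)).trans hu) hxy
  exact (key hg h).antisymm (key hf fun u hu => (h u hu).symm)

variable [Fintype V]

theorem conflicts_congr (hL : ∀ v, ∀ x ∈ L v, C.toFun x = v) {f g : V → Option W} {v : V}
    (hf : C.IsPartial L f) (hg : C.IsPartial L g)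
    (h₁ : ∀ u, G.Adj v u → f u = g u) (h₂ : ∀ u, G.Adj v u → ∀ w, G.Adj u w → f w = g w)
    {x : W} (hx : x ∈ L v) : C.conflicts L f x = C.conflicts L g x := by
  have key : ∀ {f g : V → Option W}, C.IsPartial L f → C.IsPartial L g →
      (∀ u, G.Adj v u → f u = g u) → (∀ u, G.Adj v u → ∀ w, G.Adj u w → f w = g w) →
      C.conflicts L f x ⊆ C.conflicts L g x := by
    intro f g hf hg h₁ h₂ u hu
    rw [mem_conflicts] at hu ⊢
    obtain ⟨hu, y, hy, hxy⟩ := hu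
    have hvu := adj_of_mem hL hx (mem_avail.1 hy).1 hxy
    exact ⟨(h₁ u hvu).symm.trans hu, y, avail_congr hL hf hg (h₂ u hvu) ▸ hy, hxy⟩
  exact (key hf hg h₁ h₂).antisymm
    (key hg hf (fun u hu => (h₁ u hu).symm) fun u hu w hw => (h₂ u hu w hw).symm)

theorem bad_congr (hL : ∀ v, ∀ x ∈ L v, C.toFun x = v) {m : ℕ} {f g : V → Option W} {v : V}
    (hf : C.IsPartial L f) (hg : C.IsPartial L g)
    (h₁ : ∀ u, G.Adj v u → f u = g u) (h₂ : ∀ u, G.Adj v u → ∀ w, G.Adj u w → f w = g w) :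
    C.Bad L m f v ↔ C.Bad L m g v := by
  rw [Bad, Bad, avail_congr hL hf hg h₁]
  refine or_congr_right <| exists_congr fun x =>
    and_congr_right fun hx => ?_
  rw [conflicts_congr hL hf hg h₁ h₂ (mem_avail.1 hx).1]

/-- The choices at each vertex when `f` is resampled on the neighborhood of `v`. -/
noncomputable def choices (C : Cover G W) (L : V → Finset W) (f : V → Option W) (v w : V) :
    Finset (Option W) :=
  if G.Adj v w then insertNone (C.avail L f w) else {f w}

theorem mem_piFinset_choices (hG : G.CliqueFree 3) (hL : ∀ v, ∀ x ∈ L v, C.toFun x = v)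
    {f : V → Option W} {v : V} (hf : C.IsPartial L f) (g : V → Option W) :
    g ∈ Fintype.piFinset (C.choices L f v) ↔
      C.IsPartial L g ∧ ∀ w, ¬ G.Adj v w → g w = f w := by
  rw [Fintype.mem_piFinset]
  constructor
  · intro h
    have hout : ∀ w, ¬ G.Adj v w → g w = f w := fun w hw => by simpa [choices, hw] using h w
    have hin : ∀ w x, G.Adj v w → g w = some x → x ∈ C.avail L f w := fun w x hw hx => by
      have := h w
      rw [choices, if_pos hw, mem_insertNone] at this
      exact this x hx
    refine ⟨⟨fun w x hx => ?_, fun u w x y hx hy hxy => ?_⟩, hout⟩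
    · by_cases hw : G.Adj v w
      · exact (mem_avail.1 (hin w x hw hx)).1
      · exact hf.mem ((hout w hw).symm.trans hx)
    · by_cases hu : G.Adj v u <;> by_cases hw : G.Adj v w
      · exact hG.not_adj_of_adj hu hw (adj_of_mem hL (mem_avail.1 (hin u x hu hx)).1
          (mem_avail.1 (hin w y hw hy)).1 hxy)
      · exact (mem_avail.1 (hin u x hu hx)).2 w y ((hout w hw).symm.trans hy) hxy
      · exact (mem_avail.1 (hin w y hw hy)).2 u x ((hout u hu).symm.trans hx) hxy.symm
      · exact hf.indep ((hout u hu).symm.trans hx) ((hout w hw).symm.trans hy) hxy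
  · rintro ⟨hg, hout⟩ w
    rw [choices]
    split_ifs with hw
    · rw [mem_insertNone]
      intro x hx
      rw [avail_congr hL hf hg fun u hu => (hout u fun hvu => hG.not_adj_of_adj hvu hw hu.symm).symm,
        mem_avail]
      exact ⟨hg.mem hx, fun u y hy => hg.indep hx hy⟩
    · exact mem_singleton.2 (hout w hw)

theorem card_piFinset_choices_bad_le (hG : G.CliqueFree 3)
    (hL : ∀ v, ∀ x ∈ L v, C.toFun x = v) {f : V → Option W} {v : V} (hf : C.IsPartial L f)
    {Δ k : ℕ} (hΔ : #{w | G.Adj v w} ≤ Δ) (hk : #(L v) = k) (m : ℕ) :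
    (#{g ∈ Fintype.piFinset (C.choices L f v) | C.Bad L m g v} : ℝ) ≤
      (2 ^ (4 * m) * exp (-(k / 2 * exp (-(2 * Δ / k)))) + k / 2 ^ m) *
        #(Fintype.piFinset (C.choices L f v)) := by
  set T := Fintype.piFinset (C.choices L f v) with hT
  have hmemT : ∀ g ∈ T, C.IsPartial L g ∧ ∀ w, ¬ G.Adj v w → g w = f w := fun g hg =>
    (mem_piFinset_choices hG hL hf g).1 hg
  obtain ⟨R, hR⟩ : ∃ R : W → Option W → Prop,
      ∀ x j, R x j ↔ ∃ y, j = some y ∧ C.graph.Adj x y := ⟨_, fun _ _ => Iff.rfl⟩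
  obtain ⟨P, hP⟩ : ∃ P : W → V → Option W → Prop,
      ∀ x w j, P x w j ↔ j = none ∧ ∃ y ∈ C.avail L f w, C.graph.Adj x y :=
    ⟨_, fun _ _ _ => Iff.rfl⟩
  have hchoices : ∀ w, ∀ j ∈ C.choices L f v w, ∀ x ∈ L v, ∀ y, j = some y →
      C.graph.Adj x y → G.Adj v w ∧ y ∈ C.avail L f w := by
    intro w j hj x hx y hy hxy
    rw [choices] at hj
    split_ifs at hj with hw
    · exact ⟨hw, mem_insertNone.1 hj y hy⟩
    · rw [mem_singleton] at hj
      exact absurd (adj_of_mem hL hx (hf.mem (hj.symm.trans hy)) hxy) hw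
  have hfew : (#{g ∈ T | #(C.avail L g v) < 4 * m} : ℝ) ≤
      2 ^ (4 * m) * exp (-(k / 2 * exp (-(2 * Δ / k)))) * #T := by
    have h₁ := card_piFinset_filter_few_unhit_le (C.choices L f v) ?_ {w | G.Adj v w} (L v) R
      ?_ ?_ (4 * m)
    · rw [hk] at h₁
      refine le_trans (Nat.cast_le.2 (card_le_card fun g hg => ?_)) (h₁.trans ?_)
      · rw [mem_filter] at hg ⊢
        refine ⟨hg.1, lt_of_le_of_lt (card_le_card fun x hx => ?_) hg.2⟩
        simp only [mem_filter, mem_univ, true_and] at hx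
        rw [mem_avail]
        refine ⟨hx.1, fun u y hy hxy => hx.2 u ?_ ((hR _ _).2 ⟨y, hy, hxy⟩)⟩
        exact adj_of_mem hL hx.1 ((hmemT g hg.1).1.mem hy) hxy
      · have : (#{w | G.Adj v w} : ℝ) ≤ Δ := Nat.cast_le.2 hΔ
        gcongr
    · intro w
      rw [choices]
      split_ifs
      · exact ⟨none, none_mem_insertNone⟩
      · exact singleton_nonempty _
    · intro w j hj x hx x' hx' hy hy'
      obtain ⟨y, hy, hxy⟩ := (hR _ _).1 hy
      obtain ⟨y', hy', hxy'⟩ := (hR _ _).1 hy'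
      obtain rfl : y = y' := Option.some_injective _ (hy.symm.trans hy')
      exact eq_of_adj hL hx hx' hxy.symm hxy'.symm
    · intro w x hx
      rcases ({j ∈ C.choices L f v w | R x j}).eq_empty_or_nonempty with he | ⟨j, hj⟩
      · simp [he]
      · simp only [mem_filter, hR] at hj
        obtain ⟨hj, y, hy, hxy⟩ := hj
        obtain ⟨hw, hyw⟩ := hchoices w j hj x hx y hy hxy
        have hle : #{j ∈ C.choices L f v w | R x j} ≤ 1 := by
          refine card_le_one.2 fun j₁ h₁ j₂ h₂ => ?_
          simp only [mem_filter, hR] at h₁ h₂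
          obtain ⟨h₁, y₁, rfl, hxy₁⟩ := h₁
          obtain ⟨h₂, y₂, rfl, hxy₂⟩ := h₂
          rw [eq_of_adj hL (mem_avail.1 (hchoices w _ h₁ x hx y₁ rfl hxy₁).2).1
            (mem_avail.1 (hchoices w _ h₂ x hx y₂ rfl hxy₂).2).1 hxy₁ hxy₂]
        have : 0 < #(C.avail L f w) := card_pos.2 ⟨y, hyw⟩
        have hcard : #(C.choices L f v w) = #(C.avail L f w) + 1 := by
          rw [choices, if_pos hw, card_insertNone]
        omega
  have hmany : ∀ x ∈ L v, 2 ^ m * #{g ∈ T | x ∈ C.avail L g v ∧ m ≤ #(C.conflicts L g x)} ≤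
      #T := by
    intro x hx
    refine le_trans (Nat.mul_le_mul_left _ (card_le_card fun g hg => ?_))
      (two_pow_mul_card_piFinset_filter_le (C.choices L f v)
        (P x) (fun _ => R x) ?_ m)
    · rw [mem_filter] at hg ⊢
      obtain ⟨hg, hxg, hm⟩ := hg
      obtain ⟨hgp, hgf⟩ := hmemT g hg
      refine ⟨hg, fun w hw => ?_, hm.trans (card_le_card fun w hw => ?_)⟩
      · obtain ⟨y, hy, hxy⟩ := (hR _ _).1 hw
        exact (mem_avail.1 hxg).2 w y hy hxy
      · rw [mem_conflicts] at hw
        obtain ⟨hw, y, hy, hxy⟩ := hw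
        have hvw := adj_of_mem hL hx (mem_avail.1 hy).1 hxy
        rw [mem_filter, hP]
        refine ⟨mem_univ _, hw, y, ?_, hxy⟩
        rwa [avail_congr hL hf hgp fun u hu =>
          (hgf u fun hvu => hG.not_adj_of_adj hvu hvw hu.symm).symm]
    · intro w
      by_cases hy : ∃ y ∈ C.avail L f w, C.graph.Adj x y
      · obtain ⟨y, hy, hxy⟩ := hy
        have hvw := adj_of_mem hL hx (mem_avail.1 hy).1 hxy
        refine le_trans (card_le_one.2 fun j₁ h₁ j₂ h₂ => ?_) (card_pos.2 ⟨some y, ?_⟩)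
        · rw [((hP _ _ _).1 (mem_filter.1 h₁).2).1, ((hP _ _ _).1 (mem_filter.1 h₂).2).1]
        · rw [mem_filter, choices, if_pos hvw, some_mem_insertNone, hR]
          exact ⟨hy, y, rfl, hxy⟩
      · simp [hP, hy]
  have hcover : {g ∈ T | C.Bad L m g v} ⊆ {g ∈ T | #(C.avail L g v) < 4 * m} ∪
      (L v).biUnion fun x => {g ∈ T | x ∈ C.avail L g v ∧ m ≤ #(C.conflicts L g x)} := by
    intro g hg
    simp only [mem_filter, mem_union, mem_biUnion] at hg ⊢
    obtain ⟨hg, hlt | ⟨x, hx, hm⟩⟩ := hg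
    · exact Or.inl ⟨hg, hlt⟩
    · exact Or.inr ⟨x, (mem_avail.1 hx).1, hg, hx, hm⟩
  have hsum : (∑ x ∈ L v, #{g ∈ T | x ∈ C.avail L g v ∧ m ≤ #(C.conflicts L g x)} : ℝ) ≤
      k / 2 ^ m * #T := by
    rw [← hk, div_mul_eq_mul_div, mul_div_assoc, ← nsmul_eq_mul]
    refine sum_le_card_nsmul _ _ _ fun x hx => ?_
    rw [le_div_iff₀ (by positivity), mul_comm]
    exact_mod_cast hmany x hx
  calc (#{g ∈ T | C.Bad L m g v} : ℝ)
      ≤ #{g ∈ T | #(C.avail L g v) < 4 * m} +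
        ∑ x ∈ L v, (#{g ∈ T | x ∈ C.avail L g v ∧ m ≤ #(C.conflicts L g x)} : ℝ) := by
        exact_mod_cast (card_le_card hcover).trans
          ((card_union_le _ _).trans (Nat.add_le_add_left card_biUnion_le _))
    _ ≤ _ := by
        rw [add_mul]
        exact add_le_add hfew hsum

variable [Fintype W]

theorem exists_isPartial_forall_not_bad (hG : G.CliqueFree 3)
    (hL : ∀ v, ∀ x ∈ L v, C.toFun x = v) {Δ k m : ℕ} (hΔ : ∀ v, #{w | G.Adj v w} ≤ Δ)
    (hk : ∀ v, #(L v) = k)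
    (hq : 4 * (Δ + 1 : ℝ) ^ 3 *
      (2 ^ (4 * m) * exp (-(k / 2 * exp (-(2 * Δ / k)))) + k / 2 ^ m) ≤ 1) :
    ∃ f, C.IsPartial L f ∧ ∀ v, ¬ C.Bad L m f v := by
  set q : ℝ := 2 ^ (4 * m) * exp (-(k / 2 * exp (-(2 * Δ / k)))) + k / 2 ^ m with hqdef
  set Ω : Finset (V → Option W) := {f | C.IsPartial L f} with hΩ
  set N : V → Finset V := fun v => insert v ({w | G.Adj v w} : Finset V) with hN
  have hNmem : ∀ u v, u ∈ N v ↔ u = v ∨ G.Adj v u := fun u v => by simp [hN]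
  have hNcard : ∀ v, #(N v) ≤ Δ + 1 := fun v =>
    (card_insert_le _ _).trans (Nat.add_le_add_right (hΔ v) 1)
  have hball : ∀ S : Finset V, #(S.biUnion N) ≤ #S * (Δ + 1) := fun S =>
    card_biUnion_le_card_mul _ _ _ fun v _ => hNcard v
  suffices h : ∃ f ∈ Ω, ∀ v, ¬ C.Bad L m f v by
    obtain ⟨f, hf, hB⟩ := h
    exact ⟨f, (mem_filter.1 hf).2, hB⟩
  refine exists_forall_not_of_lopsided Ω
    ⟨fun _ => none, by simpa [hΩ] using ⟨by simp, by simp⟩⟩ (fun v f => C.Bad L m f v)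
    (fun v => ((N v).biUnion N).biUnion N) ((Δ + 1) ^ 3) q
    (by positivity) (fun v => ?_) (Nat.one_le_pow _ _ (Nat.succ_pos _))
    (by push_cast; exact hq) fun v A hA => ?_
  · calc _ ≤ #(N v) * (Δ + 1) * (Δ + 1) :=
          (hball _).trans (Nat.mul_le_mul_right _ (hball _))
      _ ≤ (Δ + 1) * (Δ + 1) * (Δ + 1) := by gcongr; exact hNcard v
      _ = (Δ + 1) ^ 3 := by ring
  · rw [← filter_filter]
    refine card_filter_le_mul_of_fiberwise _ (fun f w => if G.Adj v w then none else f w)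
      (fun f => C.Bad L m f v) _ fun f hf => ?_
    simp only [hΩ, mem_filter, mem_univ, true_and] at hf
    obtain ⟨hf, hfA⟩ := hf
    have hfar : ∀ w ∈ A, ∀ u, G.Adj v u → ¬ G.Adj w u ∧ ∀ z, G.Adj w z → ¬ G.Adj z u := by
      intro w hw u hu
      have hmem : ∀ z, G.Adj z u ∨ z = u → G.Adj w z ∨ w = z → False := fun z hz hwz => by
        refine disjoint_left.1 hA hw ?_
        simp only [mem_biUnion, hNmem]
        refine ⟨z, ⟨u, Or.inr hu, ?_⟩, ?_⟩
        · rcases hz with hz | hz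
          · exact Or.inr hz.symm
          · exact Or.inl hz
        · rcases hwz with hz | hz
          · exact Or.inr hz.symm
          · exact Or.inl hz
      exact ⟨fun h => hmem u (Or.inr rfl) (Or.inl h), fun z hz h => hmem z (Or.inl h) (Or.inl hz)⟩
    have hfib : ∀ g, ((C.IsPartial L g ∧ ∀ w ∈ A, ¬ C.Bad L m g w) ∧
        (fun w => if G.Adj v w then none else g w) = fun w => if G.Adj v w then none else f w) ↔
        g ∈ Fintype.piFinset (C.choices L f v) := by
      intro g
      rw [mem_piFinset_choices hG hL hf, funext_iff]
      constructor
      · rintro ⟨⟨hg, -⟩, h⟩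
        exact ⟨hg, fun w hw => by simpa [hw] using h w⟩
      · rintro ⟨hg, h⟩
        refine ⟨⟨hg, fun w hw hbad => hfA w hw ?_⟩, fun w => ?_⟩
        · refine (bad_congr hL hg hf (fun u hu => h u fun hvu => (hfar w hw u hvu).1 hu)
            fun z hz u hu => h u fun hvu => (hfar w hw u hvu).2 z hz hu).1 hbad
        · split_ifs with hw
          · rfl
          · exact h w hw
    have h := card_piFinset_choices_bad_le hG hL hf (hΔ v) (hk v) m
    convert h using 3
    · ext g
      simp only [mem_filter, hΩ, mem_univ, true_and, ← hfib, and_assoc]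
    · congr 1
      ext g
      simp only [mem_filter, hΩ, mem_univ, true_and, ← hfib, and_assoc]

/-- Lists that are large compared to the number of conflicts of each color admit an independent
transversal on any set of vertices. -/
theorem exists_isPartial_of_conflicts_le (hL : ∀ v, ∀ x ∈ L v, C.toFun x = v) (U : Finset V)
    {m : ℕ} (hm : 0 < m) (hcard : ∀ v ∈ U, 4 * m ≤ #(L v))
    (hdeg : ∀ v ∈ U, ∀ x ∈ L v, #{u ∈ U | ∃ y ∈ L u, C.graph.Adj x y} ≤ m) :
    ∃ f, C.IsPartial L f ∧ ∀ v, f v ≠ none ↔ v ∈ U := by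
  set F : Finset V → Finset (V → Option W) :=
    fun S => {f | C.IsPartial L f ∧ ∀ v, f v ≠ none ↔ v ∈ S} with hF
  have hFmem : ∀ S f, f ∈ F S ↔ C.IsPartial L f ∧ ∀ v, f v ≠ none ↔ v ∈ S := by simp [hF]
  have growth : ∀ n, ∀ S ⊆ U, #S = n → ∀ v ∈ U, v ∉ S → 2 * m * #(F S) ≤ #(F (insert v S)) := by
    intro n
    induction n using Nat.strong_induction_on with
    | _ n ih =>
      intro S hS hSn v hv hvS
      have hcol : ∀ u ∈ S, ∀ y, 2 * m * #{f ∈ F S | f u = some y} ≤ #(F S) := by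
        intro u hu y
        have h₁ : #{f ∈ F S | f u = some y} ≤ #(F (S.erase u)) := by
          refine card_le_card_of_injOn (fun f => Function.update f u none) ?_ ?_
          · intro f hf
            simp only [coe_filter, Set.mem_ofPred_eq, hFmem] at hf
            obtain ⟨⟨hfp, hfS⟩, hfu⟩ := hf
            have hup : ∀ {w x}, Function.update f u none w = some x → f w = some x := by
              intro w x h
              rcases eq_or_ne w u with rfl | hwu
              · simp at h
              · simpa [hwu] using h
            rw [mem_coe, hFmem]
            refine ⟨⟨fun w x h => hfp.mem (hup h), fun w w' x x' h h' =>
              hfp.indep (hup h) (hup h')⟩, fun w => ?_⟩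
            rcases eq_or_ne w u with rfl | hwu
            · simp
            · simpa [hwu] using hfS w
          · intro f hf g hg hfg
            simp only [coe_filter, Set.mem_ofPred_eq] at hf hg
            funext w
            rcases eq_or_ne w u with rfl | hwu
            · rw [hf.2, hg.2]
            · simpa [hwu] using congrFun hfg w
        have h₂ := ih _ (hSn ▸ card_erase_lt_of_mem hu) (S.erase u)
          ((erase_subset _ _).trans hS) rfl u (hS hu) (notMem_erase _ _)
        rw [insert_erase hu] at h₂
        exact (Nat.mul_le_mul_left _ h₁).trans h₂
      have hbad : ∀ x ∈ L v, 2 * #{f ∈ F S | ∃ u y, f u = some y ∧ C.graph.Adj x y} ≤ #(F S) := by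
        intro x hx
        have hcover : {f ∈ F S | ∃ u y, f u = some y ∧ C.graph.Adj x y} ⊆
            ({u ∈ U | ∃ y ∈ L u, C.graph.Adj x y}).biUnion fun u =>
              {f ∈ F S | ∃ y, f u = some y ∧ C.graph.Adj x y} := by
          intro f hf
          rw [mem_filter] at hf
          obtain ⟨hf, u, y, hy, hxy⟩ := hf
          have hf' := (hFmem S f).1 hf
          simp only [mem_biUnion, mem_filter]
          exact ⟨u, ⟨hS ((hf'.2 u).1 (by simp [hy])), y, hf'.1.mem hy, hxy⟩, hf, y, hy, hxy⟩
        have hone : ∀ u ∈ U, 2 * m * #{f ∈ F S | ∃ y, f u = some y ∧ C.graph.Adj x y} ≤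
            #(F S) := by
          intro u _
          rcases ({f ∈ F S | ∃ y, f u = some y ∧ C.graph.Adj x y}).eq_empty_or_nonempty with
            he | ⟨f, hf⟩
          · simp [he]
          · rw [mem_filter] at hf
            obtain ⟨hf, y, hy, hxy⟩ := hf
            have hf' := (hFmem S f).1 hf
            refine le_trans (Nat.mul_le_mul_left _ (card_le_card fun g hg => ?_))
              (hcol u ((hf'.2 u).1 (by simp [hy])) y)
            rw [mem_filter] at hg ⊢
            obtain ⟨hg, y', hy', hxy'⟩ := hg
            have hg' := (hFmem S g).1 hg
            rw [eq_of_adj hL (hf'.1.mem hy) (hg'.1.mem hy') hxy hxy']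
            exact ⟨hg, hy'⟩
        have h₁ := (card_le_card hcover).trans card_biUnion_le
        have h₂ : 2 * m * ∑ u ∈ U with ∃ y ∈ L u, C.graph.Adj x y,
            #{f ∈ F S | ∃ y, f u = some y ∧ C.graph.Adj x y} ≤ m * #(F S) := by
          rw [mul_sum]
          refine (sum_le_card_nsmul _ _ _ fun u hu => hone u (mem_filter.1 hu).1).trans ?_
          rw [smul_eq_mul]
          exact Nat.mul_le_mul_right _ (hdeg v hv x hx)
        have h₃ := (Nat.mul_le_mul_left (2 * m) h₁).trans h₂
        rw [mul_comm 2 m, mul_assoc] at h₃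
        exact Nat.le_of_mul_le_mul_left h₃ hm
      have hgood : ∑ x ∈ L v, #{f ∈ F S | ¬ ∃ u y, f u = some y ∧ C.graph.Adj x y} ≤
          #(F (insert v S)) := by
        rw [← card_sigma]
        refine card_le_card_of_injOn (fun p => Function.update p.2 v (some p.1)) ?_ ?_
        · rintro ⟨x, f⟩ hp
          simp only [coe_sigma, Set.mem_sigma_iff, mem_coe, mem_filter, hFmem] at hp
          obtain ⟨hx, ⟨hfp, hfS⟩, hxf⟩ := hp
          have hup : ∀ {w z}, Function.update f v (some x) w = some z →
              w = v ∧ z = x ∨ f w = some z := by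
            intro w z h
            rcases eq_or_ne w v with rfl | hwv
            · exact Or.inl ⟨rfl, by simpa [eq_comm] using h⟩
            · exact Or.inr (by simpa [hwv] using h)
          rw [mem_coe, hFmem]
          refine ⟨⟨fun w z h => ?_, fun w w' z z' h h' hzz => ?_⟩, fun w => ?_⟩
          · rcases hup h with ⟨rfl, rfl⟩ | h
            · exact hx
            · exact hfp.mem h
          · rcases hup h with ⟨-, rfl⟩ | hw <;> rcases hup h' with ⟨-, rfl⟩ | hw'
            · exact hzz.ne rfl
            · exact hxf ⟨w', z', hw', hzz⟩
            · exact hxf ⟨w, z, hw, hzz.symm⟩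
            · exact hfp.indep hw hw' hzz
          · rcases eq_or_ne w v with rfl | hwv
            · simp
            · simpa [hwv] using hfS w
        · rintro ⟨x, f⟩ hp ⟨x', f'⟩ hp' h
          simp only [coe_sigma, Set.mem_sigma_iff, mem_coe, mem_filter, hFmem] at hp hp'
          have hx : x = x' := by simpa using congrFun h v
          have hf : f = f' := by
            funext w
            rcases eq_or_ne w v with rfl | hwv
            · have h₁ : f w = none := not_not.1 (mt (hp.2.1.2 w).1 hvS)
              have h₂ : f' w = none := not_not.1 (mt (hp'.2.1.2 w).1 hvS)
              rw [h₁, h₂]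
            · simpa [hwv] using congrFun h w
          rw [hx, hf]
      have hhalf : ∀ x ∈ L v,
          #(F S) ≤ 2 * #{f ∈ F S | ¬ ∃ u y, f u = some y ∧ C.graph.Adj x y} := by
        intro x hx
        have h₁ := card_filter_add_card_filter_not (s := F S)
          (fun f => ∃ u y, f u = some y ∧ C.graph.Adj x y)
        have h₂ := hbad x hx
        omega
      have h₁ : #(L v) * #(F S) ≤
          2 * ∑ x ∈ L v, #{f ∈ F S | ¬ ∃ u y, f u = some y ∧ C.graph.Adj x y} := by
        rw [mul_sum, ← smul_eq_mul]
        exact card_nsmul_le_sum _ _ _ hhalf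
      have h₂ := Nat.mul_le_mul_right (#(F S)) (hcard v hv)
      have : 2 * (2 * m * #(F S)) ≤ 2 * #(F (insert v S)) := by
        calc 2 * (2 * m * #(F S)) = 4 * m * #(F S) := by ring
          _ ≤ _ := h₂.trans (h₁.trans (Nat.mul_le_mul_left _ hgood))
      omega
  have hpos : ∀ S ⊆ U, 0 < #(F S) := by
    intro S
    induction S using Finset.induction_on with
    | empty =>
      intro _
      refine card_pos.2 ⟨fun _ => none, ?_⟩
      rw [hFmem]
      exact ⟨⟨by simp, by simp⟩, by simp⟩
    | insert v S hv ih =>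
      intro hS
      rw [insert_subset_iff] at hS
      refine lt_of_lt_of_le ?_ (growth _ S hS.2 rfl v hS.1 hv)
      have := ih hS.2
      positivity
  obtain ⟨f, hf⟩ := card_pos.1 (hpos U Subset.rfl)
  exact ⟨f, (hFmem U f).1 hf⟩

theorem colorable_of_card_eq (hG : G.CliqueFree 3)
    (hL : ∀ v, ∀ x ∈ L v, C.toFun x = v) {Δ k m : ℕ} (hm : 0 < m)
    (hΔ : ∀ v, #{w | G.Adj v w} ≤ Δ) (hk : ∀ v, #(L v) = k)
    (hq : 4 * (Δ + 1 : ℝ) ^ 3 *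
      (2 ^ (4 * m) * exp (-(k / 2 * exp (-(2 * Δ / k)))) + k / 2 ^ m) ≤ 1) :
    C.Colorable := by
  obtain ⟨f, hf, hgood⟩ := exists_isPartial_forall_not_bad hG hL hΔ hk hq
  simp only [Bad, not_or, not_lt, not_exists, not_and, not_le] at hgood
  have hav : ∀ v, ∀ x ∈ C.avail L f v, C.toFun x = v := fun v x hx => hL v x (mem_avail.1 hx).1
  obtain ⟨g, hg, hgU⟩ := exists_isPartial_of_conflicts_le (L := C.avail L f) hav
    {v | f v = none} hm (fun v _ => (hgood v).1) fun v _ x hx => by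
      refine le_trans (card_le_card fun u hu => ?_) ((hgood v).2 x hx).le
      rw [filter_filter, mem_filter] at hu
      exact mem_conflicts.2 hu.2
  refine ⟨{x | ∃ v, f v = some x ∨ g v = some x}, ?_, fun v => ?_⟩
  · rintro x ⟨u, hx⟩ y ⟨v, hy⟩ hxy
    rcases hx with hx | hx <;> rcases hy with hy | hy
    · exact hf.indep hx hy hxy
    · exact (mem_avail.1 (hg.mem hy)).2 u x hx hxy.symm
    · exact (mem_avail.1 (hg.mem hx)).2 v y hy hxy
    · exact hg.indep hx hy hxy
  · rcases h : f v with _ | x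
    · obtain ⟨x, hx⟩ := Option.ne_none_iff_exists'.1 ((hgU v).2 (by simpa using h))
      exact ⟨x, ⟨v, Or.inr hx⟩, hav v x (hg.mem hx)⟩
    · exact ⟨x, ⟨v, Or.inl h⟩, hL v x (hf.mem h)⟩

end Cover

theorem exists_threshold_le_one {Δ : ℕ} (hΔ : exp 100 ≤ Δ) :
    ∃ m : ℕ, 0 < m ∧ 4 * (Δ + 1 : ℝ) ^ 3 *
      (2 ^ (4 * m) * exp (-(⌈(120 * Δ : ℝ) / log Δ⌉₊ / 2 *
        exp (-(2 * Δ / ⌈(120 * Δ : ℝ) / log Δ⌉₊)))) +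
        ⌈(120 * Δ : ℝ) / log Δ⌉₊ / 2 ^ m) ≤ 1 := by
  have hpos : (0 : ℝ) < Δ := (Real.exp_pos _).trans_le hΔ
  set l := log (Δ : ℝ) with hl
  have hx : (Δ : ℝ) = exp l := (Real.exp_log hpos).symm
  have hl100 : 100 ≤ l := (Real.le_log_iff_exp_le hpos).2 hΔ
  set k := ⌈(120 * Δ : ℝ) / l⌉₊ with hk
  have hk₁ : 120 * exp l / l ≤ k := hx ▸ Nat.le_ceil _
  have hk₂ : (k : ℝ) ≤ 121 * exp l := by
    have h₁ := (Nat.ceil_lt_add_one (show (0 : ℝ) ≤ 120 * Δ / l by positivity)).le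
    rw [← hk, hx] at h₁
    have h₂ : 120 * exp l / l ≤ 120 * exp l := div_le_self (by positivity) (by linarith)
    have h₃ : 1 ≤ exp l := Real.one_le_exp (by linarith)
    linarith
  have hkpos : (0 : ℝ) < k := lt_of_lt_of_le (by positivity) hk₁
  have hquot : 2 * exp l / k ≤ l / 2 := by
    rw [div_le_iff₀ hkpos]
    rw [div_le_iff₀ (by linarith)] at hk₁
    nlinarith [Real.exp_pos l]
  have hsq : l ^ 2 ≤ exp (l / 2) := by
    have h₁ := Real.pow_div_factorial_le_exp (l / 2) (by linarith) 3
    norm_num [Nat.factorial] at h₁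
    nlinarith [sq_nonneg l]
  have hexp : 60 * l ≤ k / 2 * exp (-(2 * exp l / k)) := by
    calc 60 * l = 60 * l ^ 2 / l := by field_simp
      _ ≤ 60 * exp (l / 2) / l := by gcongr
      _ = 120 * exp l / l / 2 * exp (-(l / 2)) := by
          rw [show exp l = exp (l / 2) * exp (l / 2) by rw [← Real.exp_add]; ring_nf, Real.exp_neg]
          field_simp
          norm_num
      _ ≤ _ := by gcongr
  refine ⟨⌈10 * l⌉₊, Nat.ceil_pos.2 (by linarith), ?_⟩
  set m := ⌈10 * l⌉₊ with hm
  have hm₁ : 10 * l ≤ m := Nat.le_ceil _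
  have hm₂ : (m : ℝ) ≤ 10 * l + 1 := (Nat.ceil_lt_add_one (by linarith)).le
  have h2m : (2 : ℝ) ^ (4 * m) ≤ exp (40 * l + 4) := by
    calc (2 : ℝ) ^ (4 * m) ≤ exp 1 ^ (4 * m) := by
          gcongr
          linarith [Real.add_one_le_exp 1]
      _ = exp (4 * m) := by rw [← Real.exp_nat_mul]; push_cast; ring_nf
      _ ≤ _ := by gcongr; linarith
  have h2m' : exp (6 * l) ≤ 2 ^ m := by
    calc exp (6 * l) ≤ exp (m * log 2) := by
          rw [Real.exp_le_exp]
          nlinarith [Real.log_two_gt_d9]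
      _ = 2 ^ m := by rw [Real.exp_nat_mul, Real.exp_log two_pos]
  have hfirst : 2 ^ (4 * m) * exp (-(k / 2 * exp (-(2 * exp l / k)))) ≤ exp (-(5 * l)) := by
    calc _ ≤ exp (40 * l + 4) * exp (-(60 * l)) := by gcongr
      _ ≤ exp (-(5 * l)) := by
          rw [← Real.exp_add]
          gcongr
          linarith
  have hsecond : (k : ℝ) / 2 ^ m ≤ 121 * exp (-(5 * l)) := by
    calc (k : ℝ) / 2 ^ m ≤ 121 * exp l / exp (6 * l) := by gcongr
      _ = 121 * exp (-(5 * l)) := by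
          rw [mul_div_assoc, ← Real.exp_sub]
          ring_nf
  have hcube : (exp l + 1) ^ 3 ≤ 8 * exp (3 * l) := by
    have h₁ : exp l + 1 ≤ 2 * exp l := by linarith [Real.one_le_exp (show 0 ≤ l by linarith)]
    calc (exp l + 1) ^ 3 ≤ (2 * exp l) ^ 3 := by gcongr
      _ = 8 * exp (3 * l) := by
          rw [mul_pow, ← Real.exp_nat_mul]
          norm_num
  rw [hx]
  calc _ ≤ 4 * (8 * exp (3 * l)) * (exp (-(5 * l)) + 121 * exp (-(5 * l))) := by gcongr
    _ = 3904 * (exp (3 * l) * exp (-(5 * l))) := by ring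
    _ = 3904 / exp (2 * l) := by
        rw [← Real.exp_add, div_eq_mul_inv, ← Real.exp_neg]
        ring_nf
    _ ≤ 1 := by
        rw [div_le_one (Real.exp_pos _)]
        have h₁ := Real.quadratic_le_exp_of_nonneg (show 0 ≤ 2 * l by linarith)
        nlinarith

/-- **Theorem 3′ (upper bound, explicit form).** There is a constant `Δ₀` such that every
finite simple triangle-free graph with maximum degree at most `Δ ≥ Δ₀` satisfies
`χ_c(G) ≤ ⌈120Δ/ln Δ⌉`. -/
theorem corrChromaticNumber_le_of_triangleFree :
    ∃ Δ₀ : ℕ, ∀ Δ : ℕ, Δ₀ ≤ Δ →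
      ∀ (V : Type) [Fintype V] (G : SimpleGraph V) [DecidableRel G.Adj],
        G.CliqueFree 3 → G.maxDegree ≤ Δ →
        corrChromaticNumber G ≤ ⌈(120 * Δ : ℝ) / Real.log Δ⌉₊ := by
  refine ⟨⌈exp 100⌉₊, fun Δ hΔ V _ G _ hG hdeg => Nat.sInf_le fun W _ C hC => ?_⟩
  obtain ⟨m, hm, hq⟩ := exists_threshold_le_one ((Nat.le_ceil _).trans (Nat.cast_le.2 hΔ))
  have hlist : ∀ v : V, ∃ L : Finset W,
      L ⊆ ({x | C.toFun x = v} : Finset W) ∧ #L = ⌈(120 * Δ : ℝ) / Real.log Δ⌉₊ := fun v => by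
    refine exists_subset_card_eq ?_
    convert hC v
    rw [Fintype.card_subtype]
  choose L hL hk using hlist
  refine Cover.colorable_of_card_eq hG (L := L) (fun v x hx => (mem_filter.1 (hL v hx)).2) hm
    (fun v => ?_) hk hq
  refine le_trans (le_of_eq ?_) ((G.degree_le_maxDegree v).trans hdeg)
  rw [← G.card_neighborFinset_eq_degree]
  congr 1
  ext w
  simp
end

section
/- (Probabilistic Coloring Lemma) Let (L,H) be a cover of a finite simple graph G and let p: V(H) → ℝ_{≥0}. Suppose there exists a positive constant δ such that: (1) for each v ∈ V(G), p(v) ≥ δ; (2) for each v ∈ V(G) and x ∈ L(v), p(x) ≤ δ/2; and (3) for each v ∈ V(G), Σ_{u∈N_G(v)} p(uv) ≤ δ²/4. Then G is (L,H)-colorable. -/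
open Classical Finset Real

namespace Cover

variable {V W : Type} {G : SimpleGraph V}

open Classical in
/-- `p(v) = Σ_{x ∈ L(v)} p(x)`. -/
noncomputable def vertexWeight [Fintype W] (C : Cover G W) (p : W → ℝ) (v : V) : ℝ :=
  ∑ x : W, if C.toFun x = v then p x else 0

open Classical in
/-- `p(uv) = Σ p(x)p(y)`, the sum over edges `xy` of `H` with `x ∈ L(u)`, `y ∈ L(v)`. -/
noncomputable def edgeWeight [Fintype W] (C : Cover G W) (p : W → ℝ) (u v : V) : ℝ :=
  ∑ x : W, ∑ y : W,
    if C.toFun x = u ∧ C.toFun y = v ∧ C.graph.Adj x y then p x * p y else 0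

end Cover

namespace Cover

variable {V W : Type} {G : SimpleGraph V} [Fintype W]

/-- The independent sets of the cover graph that pick exactly one color from the list of each
vertex of `S`, and no other color. -/
noncomputable def partialColorings (C : Cover G W) (S : Finset V) : Finset (Finset W) :=
  univ.filter fun I => (∀ x ∈ I, ∀ y ∈ I, ¬ C.graph.Adj x y) ∧
    I.image C.toFun = S ∧ Set.InjOn C.toFun I

/-- The total weight of the partial colorings of `S`, a set of colors being weighted by the
product of the weights of its elements. -/
noncomputable def partialColoringWeight (C : Cover G W) (p : W → ℝ) (S : Finset V) : ℝ :=
  ∑ I ∈ C.partialColorings S, ∏ x ∈ I, p x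

lemma mem_partialColorings {C : Cover G W} {S : Finset V} {I : Finset W} :
    I ∈ C.partialColorings S ↔ (∀ x ∈ I, ∀ y ∈ I, ¬ C.graph.Adj x y) ∧
      I.image C.toFun = S ∧ Set.InjOn C.toFun I := by
  simp [partialColorings]

lemma toFun_mem_of_mem_partialColorings {C : Cover G W} {S : Finset V} {I : Finset W}
    (hI : I ∈ C.partialColorings S) {x : W} (hx : x ∈ I) : C.toFun x ∈ S := by
  rw [← (mem_partialColorings.1 hI).2.1]
  exact mem_image_of_mem _ hx

lemma partialColoringWeight_empty (C : Cover G W) (p : W → ℝ) :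
    C.partialColoringWeight p ∅ = 1 := by
  have h : C.partialColorings ∅ = {∅} := by
    ext I
    rw [mem_partialColorings, mem_singleton, image_eq_empty]
    constructor
    · exact fun h => h.2.1
    · rintro rfl
      simp
  simp [partialColoringWeight, h]

lemma partialColoringWeight_nonneg (C : Cover G W) {p : W → ℝ} (hp : ∀ x, 0 ≤ p x)
    (S : Finset V) : 0 ≤ C.partialColoringWeight p S :=
  sum_nonneg fun _ _ => prod_nonneg fun x _ => hp x

lemma erase_mem_partialColorings {C : Cover G W} {S : Finset V} {I : Finset W}
    (hI : I ∈ C.partialColorings S) {y : W} (hy : y ∈ I) :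
    I.erase y ∈ C.partialColorings (S.erase (C.toFun y)) := by
  obtain ⟨hind, himg, hinj⟩ := mem_partialColorings.1 hI
  refine mem_partialColorings.2 ⟨fun x hx z hz => hind x (mem_of_mem_erase hx) z
    (mem_of_mem_erase hz), ?_, hinj.mono (by simp)⟩
  ext u
  simp only [← himg, mem_image, mem_erase]
  constructor
  · rintro ⟨x, ⟨hxy, hx⟩, rfl⟩
    exact ⟨fun h => hxy (hinj hx hy h), x, hx, rfl⟩
  · rintro ⟨hu, x, hx, rfl⟩
    exact ⟨x, ⟨fun h => hu (h ▸ rfl), hx⟩, rfl⟩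

lemma insert_mem_partialColorings {C : Cover G W} {S : Finset V} {J : Finset W}
    (hJ : J ∈ C.partialColorings S) {x : W} (hx : C.toFun x ∉ S)
    (hadj : ∀ y ∈ J, ¬ C.graph.Adj x y) :
    insert x J ∈ C.partialColorings (insert (C.toFun x) S) := by
  obtain ⟨hind, himg, hinj⟩ := mem_partialColorings.1 hJ
  refine mem_partialColorings.2 ⟨?_, by rw [image_insert, himg], ?_⟩
  · intro a ha b hb
    rcases mem_insert.1 ha with rfl | haJ <;> rcases mem_insert.1 hb with rfl | hbJ
    · exact C.graph.loopless.irrefl _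
    · exact hadj b hbJ
    · exact fun h => hadj a haJ h.symm
    · exact hind a haJ b hbJ
  · have hxJ : x ∉ J := fun h => hx (toFun_mem_of_mem_partialColorings hJ h)
    rw [coe_insert, Set.injOn_insert (by simpa using hxJ)]
    refine ⟨hinj, ?_⟩
    rintro ⟨z, hz, hzx⟩
    exact hx (hzx ▸ toFun_mem_of_mem_partialColorings hJ (mem_coe.1 hz))

lemma sum_partialColorings_mem_le (C : Cover G W) {p : W → ℝ} (hp : ∀ x, 0 ≤ p x)
    (S : Finset V) (y : W) :
    ∑ I ∈ C.partialColorings S with y ∈ I, ∏ x ∈ I, p x ≤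
      p y * C.partialColoringWeight p (S.erase (C.toFun y)) := by
  have hinj : Set.InjOn (fun I : Finset W => I.erase y)
      ((C.partialColorings S).filter (y ∈ ·) : Finset (Finset W)) := by
    intro I hI J hJ h
    rw [← insert_erase (mem_filter.1 hI).2, ← insert_erase (mem_filter.1 hJ).2]
    exact congrArg (insert y) h
  calc ∑ I ∈ C.partialColorings S with y ∈ I, ∏ x ∈ I, p x
      = ∑ I ∈ C.partialColorings S with y ∈ I, p y * ∏ x ∈ I.erase y, p x :=
        sum_congr rfl fun I hI => (mul_prod_erase I p (mem_filter.1 hI).2).symm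
    _ = p y * ∑ J ∈ ((C.partialColorings S).filter (y ∈ ·)).image (·.erase y),
          ∏ x ∈ J, p x := by rw [← mul_sum, sum_image hinj]
    _ ≤ _ := by
        refine mul_le_mul_of_nonneg_left (sum_le_sum_of_subset_of_nonneg ?_
          fun _ _ _ => prod_nonneg fun x _ => hp x) (hp y)
        intro J hJ
        obtain ⟨I, hI, rfl⟩ := mem_image.1 hJ
        exact erase_mem_partialColorings (mem_filter.1 hI).1 (mem_filter.1 hI).2

lemma sum_extensions_le (C : Cover G W) {p : W → ℝ} (hp : ∀ x, 0 ≤ p x)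
    {S : Finset V} {v : V} (hv : v ∉ S) :
    ∑ x with C.toFun x = v, ∑ J ∈ C.partialColorings S with ∀ y ∈ J, ¬ C.graph.Adj x y,
      p x * ∏ y ∈ J, p y ≤ C.partialColoringWeight p (insert v S) := by
  set T := ((univ.filter (C.toFun · = v)).sigma
    fun x => (C.partialColorings S).filter fun J => ∀ y ∈ J, ¬ C.graph.Adj x y) with hT
  have hmem : ∀ a ∈ T, C.toFun a.1 = v ∧ a.2 ∈ C.partialColorings S ∧
      ∀ y ∈ a.2, ¬ C.graph.Adj a.1 y := by
    intro a ha
    simpa [hT] using ha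
  have hnot : ∀ a ∈ T, ∀ b ∈ T, a.1 ∉ b.2 := fun a ha b hb h =>
    hv ((hmem a ha).1 ▸ toFun_mem_of_mem_partialColorings (hmem b hb).2.1 h)
  have hinj : Set.InjOn (fun a : (_ : W) × Finset W => insert a.1 a.2) T := by
    rintro ⟨x, I⟩ ha ⟨y, J⟩ hb h
    have hxJ : x ∉ J := hnot _ ha _ hb
    have hxI : x ∉ I := hnot _ ha _ ha
    have hyJ : y ∉ J := hnot _ hb _ hb
    have h' : insert x I = insert y J := h
    have hxy : x = y := by
      have : x ∈ insert y J := h' ▸ mem_insert_self x I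
      exact (mem_insert.1 this).resolve_right hxJ
    subst hxy
    have hIJ : I = J := by rw [← erase_insert hxI, h', erase_insert hyJ]
    rw [hIJ]
  calc _ = ∑ a ∈ T, p a.1 * ∏ y ∈ a.2, p y := by rw [hT, sum_sigma]
    _ = ∑ a ∈ T, ∏ y ∈ insert a.1 a.2, p y :=
        sum_congr rfl fun a ha => (prod_insert (hnot a ha a ha)).symm
    _ = ∑ I ∈ T.image fun a => insert a.1 a.2, ∏ y ∈ I, p y :=
        (sum_image (f := fun I => ∏ y ∈ I, p y) hinj).symm
    _ ≤ _ := by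
        refine sum_le_sum_of_subset_of_nonneg ?_ fun _ _ _ => prod_nonneg fun x _ => hp x
        intro I hI
        obtain ⟨a, ha, rfl⟩ := mem_image.1 hI
        obtain ⟨rfl, hJ, hadj⟩ := hmem a ha
        exact insert_mem_partialColorings hJ hv hadj

lemma sum_conflicts [Fintype V] [DecidableRel G.Adj] (C : Cover G W) (p : W → ℝ) (v : V) :
    ∑ x with C.toFun x = v, ∑ y with C.graph.Adj x y, p x * p y =
      ∑ u ∈ G.neighborFinset v, C.edgeWeight p u v := by
  have hswap : ∑ u ∈ G.neighborFinset v, C.edgeWeight p u v =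
      ∑ x : W, ∑ y : W, ∑ u ∈ G.neighborFinset v,
        if C.toFun y = u ∧ C.toFun x = v ∧ C.graph.Adj y x then p y * p x else 0 := by
    simp only [edgeWeight]
    rw [sum_comm, sum_comm (s := (univ : Finset W)) (t := (univ : Finset W))]
    exact sum_congr rfl fun y _ => sum_comm
  rw [hswap, sum_filter]
  refine sum_congr rfl fun x _ => ?_
  split_ifs with hx
  · rw [sum_filter]
    refine sum_congr rfl fun y _ => ?_
    split_ifs with hxy
    · have hy : G.Adj v (C.toFun y) := hx ▸ C.adj_map hxy
      simp [hx, hxy.symm, hy, mul_comm]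
    · have hyx : ¬ C.graph.Adj y x := fun h => hxy h.symm
      simp [hyx]
  · simp [hx]

lemma vertexWeight_mul_sub_le (C : Cover G W) {p : W → ℝ} (hp : ∀ x, 0 ≤ p x)
    {S : Finset V} {v : V} (hv : v ∉ S) :
    C.vertexWeight p v * C.partialColoringWeight p S -
      ∑ x with C.toFun x = v, ∑ y with C.graph.Adj x y,
        p x * ∑ J ∈ C.partialColorings S with y ∈ J, ∏ z ∈ J, p z ≤
      C.partialColoringWeight p (insert v S) := by
  refine le_trans ?_ (C.sum_extensions_le hp hv)
  rw [vertexWeight, ← sum_filter, sum_mul, ← sum_sub_distrib]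
  refine sum_le_sum fun x _ => ?_
  rw [← mul_sum, ← mul_sum, ← mul_sub]
  refine mul_le_mul_of_nonneg_left ?_ (hp x)
  simp only [partialColoringWeight, sum_filter (fun J : Finset W => _ ∈ J)]
  rw [sum_comm, ← sum_sub_distrib, sum_filter]
  refine sum_le_sum fun J _ => ?_
  have hw : 0 ≤ ∏ z ∈ J, p z := prod_nonneg fun z _ => hp z
  have hnn : ∀ y ∈ univ.filter (C.graph.Adj x), 0 ≤ if y ∈ J then ∏ z ∈ J, p z else 0 := by
    intro y _
    split_ifs <;> simp [hw]
  split_ifs with h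
  · linarith [sum_nonneg hnn]
  · push Not at h
    obtain ⟨y, hyJ, hxy⟩ := h
    have := single_le_sum hnn (mem_filter.2 ⟨mem_univ y, hxy⟩)
    rw [if_pos hyJ] at this
    linarith

lemma partialColoringWeight_insert_ge [Fintype V] [DecidableRel G.Adj] (C : Cover G W)
    {p : W → ℝ} (hp : ∀ x, 0 ≤ p x) {δ : ℝ} (hδ : 0 < δ) (h1 : ∀ v : V, δ ≤ C.vertexWeight p v)
    (h3 : ∀ v : V, ∑ u ∈ G.neighborFinset v, C.edgeWeight p u v ≤ δ ^ 2 / 4)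
    (S : Finset V) : ∀ v ∉ S,
      δ / 2 * C.partialColoringWeight p S ≤ C.partialColoringWeight p (insert v S) := by
  induction S using Finset.strongInduction with
  | H S ih =>
  intro v hv
  have hZ := C.partialColoringWeight_nonneg hp S
  have hmem : ∀ y : W, ∑ J ∈ C.partialColorings S with y ∈ J, ∏ z ∈ J, p z ≤
      p y * (2 / δ * C.partialColoringWeight p S) := by
    intro y
    by_cases hy : C.toFun y ∈ S
    · refine (C.sum_partialColorings_mem_le hp S y).trans
        (mul_le_mul_of_nonneg_left ?_ (hp y))
      have := ih _ (erase_ssubset hy) _ (notMem_erase _ _)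
      rw [insert_erase hy] at this
      calc _ = 2 / δ * (δ / 2 * C.partialColoringWeight p (S.erase (C.toFun y))) := by
            field_simp
        _ ≤ _ := by gcongr
    · rw [filter_false_of_mem fun J hJ h => hy (toFun_mem_of_mem_partialColorings hJ h),
        sum_empty]
      have := hp y
      positivity
  have hconf : ∑ x with C.toFun x = v, ∑ y with C.graph.Adj x y,
        p x * ∑ J ∈ C.partialColorings S with y ∈ J, ∏ z ∈ J, p z ≤
      δ / 2 * C.partialColoringWeight p S :=
    calc _ ≤ ∑ x with C.toFun x = v, ∑ y with C.graph.Adj x y,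
          p x * p y * (2 / δ * C.partialColoringWeight p S) :=
          sum_le_sum fun x _ => sum_le_sum fun y _ => by
            rw [mul_assoc]
            exact mul_le_mul_of_nonneg_left (hmem y) (hp x)
      _ = (∑ u ∈ G.neighborFinset v, C.edgeWeight p u v) *
          (2 / δ * C.partialColoringWeight p S) := by
          rw [← C.sum_conflicts]
          simp only [sum_mul]
      _ ≤ δ ^ 2 / 4 * (2 / δ * C.partialColoringWeight p S) := by
          gcongr
          exact h3 v
      _ = _ := by
          field_simp
          ring
  have hv1 := mul_le_mul_of_nonneg_right (h1 v) hZ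
  linarith [C.vertexWeight_mul_sub_le hp hv]

lemma colorable_of_partialColoringWeight_pos [Fintype V] (C : Cover G W) {p : W → ℝ}
    (h : 0 < C.partialColoringWeight p univ) : C.Colorable := by
  obtain ⟨I, hI, -⟩ := exists_ne_zero_of_sum_ne_zero h.ne'
  obtain ⟨hind, himg, -⟩ := mem_partialColorings.1 hI
  refine ⟨I, fun x hx y hy => hind x hx y hy, fun v => ?_⟩
  have hv : v ∈ I.image C.toFun := himg ▸ mem_univ v
  simpa using hv

end Cover

/-- **Probabilistic Coloring Lemma.** If `(L,H)` is a cover of `G`, `p : V(H) → ℝ≥0`, and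
there is `δ > 0` with (1) `p(v) ≥ δ` for every vertex `v`, (2) `p(x) ≤ δ/2` for every color
`x`, and (3) `Σ_{u ∈ N_G(v)} p(uv) ≤ δ²/4` for every vertex `v`, then `G` is
`(L,H)`-colorable. -/
theorem probabilistic_coloring_lemma
    {V W : Type} [Fintype V] [Fintype W] {G : SimpleGraph V} [DecidableRel G.Adj]
    (C : Cover G W) (p : W → ℝ) (hp : ∀ x, 0 ≤ p x)
    (δ : ℝ) (hδ : 0 < δ)
    (h1 : ∀ v : V, δ ≤ C.vertexWeight p v)
    (h2 : ∀ x : W, p x ≤ δ / 2)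
    (h3 : ∀ v : V, ∑ u ∈ G.neighborFinset v, C.edgeWeight p u v ≤ δ ^ 2 / 4) :
    C.Colorable := by
  have hpos : ∀ S : Finset V, 0 < C.partialColoringWeight p S := by
    intro S
    induction S using Finset.induction_on with
    | empty => simp [C.partialColoringWeight_empty p]
    | insert v S hv ih =>
      exact (mul_pos (half_pos hδ) ih).trans_le
        (C.partialColoringWeight_insert_ge hp hδ h1 h3 S v hv)
  exact C.colorable_of_partialColoringWeight_pos (hpos univ)
end
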